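/- arXiv:2209.08134 — 2 statements merged into one kernel-verified Lean document; each statement's English description precedes it below -/
import Mathlib

section
/- There exists ε₂⁰ > 0 such that for every ε₂ ∈ (0, ε₂⁰) there exists ε₁⁰ > 0 such that for every ε₁ ∈ (0, ε₁⁰) there exists n₀ such that the following holds for all n ≥ n₀. Let G be a coloured graph on n vertices with c(G) ≥ f(n) − ε₁n³. Then there is a coloured graph G' on the same vertex set satisfying: (a) c(G') ≥ c(G); (b) G and G' differ on at most ε₂n² pairs; (c) the vertex set can be partitioned into nonempty sets Q₁, …, Q_t such that |Q₁| ≥ … ≥ |Q_t|, every pair of distinct vertices inside each Q_i is blue in G', every pair {x,y} with x ∈ Q_i, y ∈ Q_j and i < j is red in G' and directed from y to x, and | |Q_i| − β·|Q_i ∪ … ∪ Q_t| | ≤ ε₂n for every i ∈ {1,…,t}. -/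
/-- `f 0 = f 1 = 0` and, for `n ≥ 2`,
`f n = max over 1 ≤ k ≤ n − 1 of (k choose 2)·(n − k) + f (n − k)`
(here `k = j + 1` ranges over `1, …, n − 1`). -/
def f : ℕ → ℕ
  | 0 => 0
  | 1 => 0
  | n + 2 =>
    (Finset.range (n + 1)).sup fun j =>
      Nat.choose (j + 1) 2 * (n + 1 - j) + f (n + 1 - j)
  decreasing_by omega
/-- A coloured graph on `V`: every pair of distinct vertices is either blue, or red with
an orientation (`Red x y` means red, directed from `x` to `y`). -/
structure ColouredGraph (V : Type) where
  Blue : V → V → Prop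
  Red : V → V → Prop
  blue_symm : ∀ x y, Blue x y → Blue y x
  trichotomy : ∀ x y : V, x ≠ y →
    (Blue x y ∧ ¬ Red x y ∧ ¬ Red y x) ∨
    (¬ Blue x y ∧ Red x y ∧ ¬ Red y x) ∨
    (¬ Blue x y ∧ ¬ Red x y ∧ Red y x)

/-- A cherry of `G`: a 3-element set `{x, y, z}` with `Red x y`, `Red x z` and `Blue y z`. -/
def IsCherry {V : Type} [DecidableEq V] (G : ColouredGraph V) (e : Finset V) : Prop :=
  ∃ x y z : V, x ≠ y ∧ x ≠ z ∧ y ≠ z ∧ e = ({x, y, z} : Finset V) ∧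
    G.Red x y ∧ G.Red x z ∧ G.Blue y z

/-- `c(G)`, the number of cherries of `G`. -/
noncomputable def cherryCount {V : Type} [DecidableEq V] (G : ColouredGraph V) : ℕ :=
  Set.ncard {e : Finset V | IsCherry G e}
/-- The set of (unordered) pairs on which the coloured graphs `G` and `G'` differ,
i.e. the pair does not get the same colour (with the same orientation, if red) in both. -/
def diffPairs {V : Type} [DecidableEq V] (G G' : ColouredGraph V) : Set (Finset V) :=
  { e | ∃ x y : V, x ≠ y ∧ e = ({x, y} : Finset V) ∧
      ¬ ((G.Blue x y ↔ G'.Blue x y) ∧ (G.Red x y ↔ G'.Red x y) ∧ (G.Red y x ↔ G'.Red y x)) }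



theorem f_ge (n k : ℕ) (h1 : 1 ≤ k) (h2 : k ≤ n) :
    Nat.choose k 2 * (n - k) + f (n - k) ≤ f n := by
  rcases Nat.lt_or_ge k n with h | h
  · obtain ⟨m, rfl⟩ : ∃ m, n = m + 2 := ⟨n - 2, by omega⟩
    obtain ⟨j, rfl⟩ : ∃ j, k = j + 1 := ⟨k - 1, by omega⟩
    conv_rhs => rw [f]
    have e : m + 2 - (j + 1) = m + 1 - j := by omega
    rw [e]
    exact Finset.le_sup (f := fun j => Nat.choose (j + 1) 2 * (m + 1 - j) + f (m + 1 - j))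
      (Finset.mem_range.2 (by omega))
  · have : n - k = 0 := by omega
    rw [this]; simp [f]

theorem f_ex (n : ℕ) (h : 1 ≤ n) : ∃ k, 1 ≤ k ∧ k ≤ n ∧
    f n = Nat.choose k 2 * (n - k) + f (n - k) := by
  rcases Nat.lt_or_ge n 2 with h2 | h2
  · obtain rfl : n = 1 := by omega
    exact ⟨1, le_rfl, le_rfl, by simp [f]⟩
  · obtain ⟨m, rfl⟩ : ∃ m, n = m + 2 := ⟨n - 2, by omega⟩
    obtain ⟨j, hj, e⟩ := Finset.exists_mem_eq_sup (Finset.range (m + 1)) ⟨0, by simp⟩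
      (fun j => Nat.choose (j + 1) 2 * (m + 1 - j) + f (m + 1 - j))
    rw [Finset.mem_range] at hj
    refine ⟨j + 1, by omega, by omega, ?_⟩
    rw [f, e]
    have e : m + 2 - (j + 1) = m + 1 - j := by omega
    rw [e]

/-- A chosen maximiser in the recursion. -/
noncomputable def kk (n : ℕ) : ℕ := if h : 1 ≤ n then (f_ex n h).choose else 0

theorem kk_zero : kk 0 = 0 := by simp [kk]

theorem kk_spec (n : ℕ) (h : 1 ≤ n) : 1 ≤ kk n ∧ kk n ≤ n ∧
    f n = Nat.choose (kk n) 2 * (n - kk n) + f (n - kk n) := by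
  have := (f_ex n h).choose_spec
  rw [kk, dif_pos h]; exact this

theorem kk_le (n : ℕ) : kk n ≤ n := by
  rcases Nat.eq_zero_or_pos n with h | h
  · subst h; simp [kk_zero]
  · exact (kk_spec n h).2.1

theorem choose_two_real (k : ℕ) : ((Nat.choose k 2 : ℕ) : ℝ) = (k : ℝ) * (k - 1) / 2 := by
  rw [Nat.cast_choose_two]

theorem kk_mono (n : ℕ) : kk (n - kk n) ≤ kk n := by
  by_contra hlt
  push Not at hlt
  have hm : 1 ≤ n - kk n := by
    by_contra h0
    have : n - kk n = 0 := by omega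
    rw [this, kk_zero] at hlt; omega
  have hn : 1 ≤ n := by omega
  obtain ⟨a1, a2, a3⟩ := kk_spec n hn
  obtain ⟨b1, b2, b3⟩ := kk_spec _ hm
  set a := kk n with ha
  set b := kk (n - a) with hb
  obtain ⟨r, hr⟩ : ∃ r, n = a + b + r := ⟨n - a - b, by omega⟩
  have c1 := f_ge n b b1 (by omega)
  have c2 := f_ge (n - b) a a1 (by omega)
  have e1 : n - a = b + r := by omega
  have e2 : n - b = a + r := by omega
  have e3 : n - a - b = r := by omega
  have e4 : n - b - a = r := by omega
  rw [e3, e1] at b3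
  rw [e4, e2] at c2
  rw [e1] at a3
  rw [e2] at c1
  have e5 : b + r - b = r := by omega
  have e6 : a + r - a = r := by omega
  simp only [e5, e6] at *
  have d : (f n : ℝ) = (Nat.choose a 2 : ℕ) * (b + r) + ((Nat.choose b 2 : ℕ) * r + f r) := by
    rw [a3, b3]; push_cast; ring
  have d' : ((Nat.choose b 2 : ℕ) : ℝ) * (a + r) + ((Nat.choose a 2 : ℕ) * r + f r) ≤ f n := by
    have := c1.trans' (Nat.add_le_add_left c2 _)
    exact_mod_cast this
  rw [choose_two_real, choose_two_real] at d d'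
  have ha' : (1 : ℝ) ≤ a := by exact_mod_cast a1
  have hb' : (1 : ℝ) ≤ b := by exact_mod_cast b1
  have hab : (a : ℝ) + 1 ≤ b := by exact_mod_cast hlt
  nlinarith [mul_pos (by linarith : (0 : ℝ) < a) (by linarith : (0 : ℝ) < b)]

/-- twice the limiting cherry density constant -/
noncomputable def tau : ℝ := (2 * Real.sqrt 3 - 3) / 3
noncomputable def bet : ℝ := (3 - Real.sqrt 3) / 2

theorem sqrt3_bounds : (1.732 : ℝ) < Real.sqrt 3 ∧ Real.sqrt 3 < 1.7321 := by
  constructor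
  · exact Real.lt_sqrt_of_sq_lt (by norm_num)
  · rw [Real.sqrt_lt' (by norm_num)]; norm_num

theorem sqrt3_sq : Real.sqrt 3 * Real.sqrt 3 = 3 := Real.mul_self_sqrt (by norm_num)

theorem tau_bounds : (0.154 : ℝ) < tau ∧ tau < 0.155 := by
  have := sqrt3_bounds; unfold tau; constructor <;> linarith [this.1, this.2]

theorem bet_bounds : (0.633 : ℝ) < bet ∧ bet < 0.634 := by
  have := sqrt3_bounds; unfold bet; constructor <;> linarith [this.1, this.2]

/-- the key cubic identity -/
theorem cubic_id (n k : ℝ) : k ^ 2 * (n - k) + tau * (n - k) ^ 3 =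
    tau * n ^ 3 - (2 * Real.sqrt 3 / 3) * k * (k - bet * n) ^ 2 := by
  have h := sqrt3_sq
  have h2 : Real.sqrt 3 ^ 2 = 3 := by rw [sq]; exact h
  have h3 : Real.sqrt 3 ^ 3 = 3 * Real.sqrt 3 := by rw [pow_succ, h2]
  unfold tau bet
  ring_nf
  rw [h2, h3]
  ring

theorem cubic_le (n k : ℝ) (hk : 0 ≤ k) : k ^ 2 * (n - k) + tau * (n - k) ^ 3 ≤ tau * n ^ 3 := by
  rw [cubic_id]
  have : 0 ≤ (2 * Real.sqrt 3 / 3) * k * (k - bet * n) ^ 2 := by positivity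
  linarith

theorem f_le (n : ℕ) : 2 * (f n : ℝ) ≤ tau * (n : ℝ) ^ 3 := by
  induction n using Nat.strong_induction_on with
  | _ n ih =>
    rcases Nat.eq_zero_or_pos n with h | h
    · subst h; simp [f]
    · obtain ⟨a1, a2, a3⟩ := kk_spec n h
      have := ih (n - kk n) (by omega)
      rw [a3]
      push_cast [Nat.cast_sub a2] at this ⊢
      rw [choose_two_real]
      have h1 := cubic_le n (kk n) (by positivity)
      have h2 : (0 : ℝ) ≤ (kk n) * ((n : ℝ) - kk n) :=
        mul_nonneg (by positivity) (sub_nonneg.2 (by exact_mod_cast a2))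
      nlinarith

theorem f_lower (n : ℕ) : tau * (n : ℝ) ^ 3 - 2 * (n : ℝ) ^ 2 ≤ 2 * (f n : ℝ) := by
  induction n using Nat.strong_induction_on with
  | _ n ih =>
    have ht := tau_bounds
    have hb := bet_bounds
    have hs := sqrt3_bounds
    rcases Nat.lt_or_ge n 8 with h | h
    · have h0 : (0 : ℝ) ≤ f n := by positivity
      have h8 : (n : ℝ) ≤ 8 := by exact_mod_cast h.le
      have hn0 : (0 : ℝ) ≤ n := by positivity
      have : tau * (n : ℝ) ≤ 2 := by nlinarith [ht.1, ht.2]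
      nlinarith [sq_nonneg (n : ℝ)]
    · have h8 : (8 : ℝ) ≤ n := by exact_mod_cast h
      set k := ⌊bet * n⌋₊ with hk
      have k1 : (k : ℝ) ≤ bet * n := Nat.floor_le (by nlinarith [hb.1])
      have k2 : bet * n < k + 1 := Nat.lt_floor_add_one _
      have k3 : (4 : ℝ) ≤ k := by
        have : 4 ≤ k := by
          rw [hk]; apply Nat.le_floor; push_cast; nlinarith [hb.1]
        exact_mod_cast this
      have kn : (k : ℝ) ≤ n := by nlinarith [hb.1, hb.2]
      have kn' : k ≤ n := by exact_mod_cast kn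
      have k4 : 4 ≤ k := by exact_mod_cast k3
      have i := ih (n - k) (by omega)
      have g : ((Nat.choose k 2 * (n - k) + f (n - k) : ℕ) : ℝ) ≤ f n := by
        exact_mod_cast f_ge n k (by omega) kn'
      push_cast [Nat.cast_sub kn'] at g i
      rw [choose_two_real] at g
      have c := cubic_id n k
      have q : ((k : ℝ) - bet * n) ^ 2 ≤ 1 := by nlinarith
      have q2 : (2 * Real.sqrt 3 / 3) * k * ((k : ℝ) - bet * n) ^ 2 ≤ 2 * k := by
        have : (2 * Real.sqrt 3 / 3) * k ≤ 2 * k := by nlinarith [hs.2]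
        have h0 : 0 ≤ (2 * Real.sqrt 3 / 3) * k := by positivity
        nlinarith
      nlinarith

theorem f_le_kk (n : ℕ) : 2 * (f n : ℝ) ≤ kk n * (n : ℝ) ^ 2 := by
  induction n using Nat.strong_induction_on with
  | _ n ih =>
    rcases Nat.eq_zero_or_pos n with h | h
    · subst h; simp [f]
    · obtain ⟨a1, a2, a3⟩ := kk_spec n h
      have := ih (n - kk n) (by omega)
      have hm : (kk (n - kk n) : ℝ) ≤ kk n := by exact_mod_cast kk_mono n
      rw [a3]
      have h0 : (0 : ℝ) ≤ (n : ℝ) - kk n := sub_nonneg.2 (by exact_mod_cast a2)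
      push_cast [Nat.cast_sub a2] at this ⊢
      rw [choose_two_real]
      have h1 : (0 : ℝ) ≤ kk n := by positivity
      have h2 : (kk (n - kk n) : ℝ) * ((n : ℝ) - kk n) ^ 2 ≤ kk n * ((n : ℝ) - kk n) ^ 2 := by
        gcongr
      have h3 := mul_nonneg h1 h0
      have h4 : (0 : ℝ) ≤ (kk n : ℝ) ^ 2 * n := by positivity
      nlinarith

theorem kk_near (δ : ℝ) (hδ : 0 < δ) : ∃ m₀ : ℕ, ∀ m : ℕ, m₀ ≤ m →
    |(kk m : ℝ) - bet * m| ≤ δ * m := by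
  obtain ⟨m₀, hm₀⟩ := exists_nat_gt (max 100 (100 / δ ^ 2))
  refine ⟨m₀, fun m hm => ?_⟩
  have hm' : (m₀ : ℝ) ≤ m := by exact_mod_cast hm
  have m1 : (100 : ℝ) < m := (le_max_left _ _).trans_lt (hm₀.trans_le hm')
  have m2 : 100 / δ ^ 2 < m := (le_max_right _ _).trans_lt (hm₀.trans_le hm')
  rw [div_lt_iff₀ (by positivity)] at m2
  have ht := tau_bounds
  have hs := sqrt3_bounds
  have mp : (0 : ℝ) < m := by linarith
  have a := f_lower m
  have b := f_le_kk m
  have hk : 0.1 * (m : ℝ) ≤ kk m := by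
    by_contra hc
    push Not at hc
    nlinarith [sq_pos_of_pos mp, mul_pos (sq_pos_of_pos mp) mp]
  obtain ⟨a1, a2, a3⟩ := kk_spec m (by exact_mod_cast (by linarith : (1 : ℝ) ≤ m))
  have u := f_le (m - kk m)
  rw [a3] at a
  push_cast [Nat.cast_sub a2] at a u
  rw [choose_two_real] at a
  have c := cubic_id m (kk m)
  have h0 : (0 : ℝ) ≤ (m : ℝ) - kk m := sub_nonneg.2 (by exact_mod_cast a2)
  have h1 : (0 : ℝ) ≤ kk m := by positivity
  have h2 := mul_nonneg h1 h0
  have key : (2 * Real.sqrt 3 / 3) * kk m * ((kk m : ℝ) - bet * m) ^ 2 ≤ 2 * (m : ℝ) ^ 2 := by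
    nlinarith
  have key2 : 0.1 * (m : ℝ) * ((kk m : ℝ) - bet * m) ^ 2 ≤ 2 * (m : ℝ) ^ 2 := by
    refine le_trans (mul_le_mul_of_nonneg_right ?_ (sq_nonneg _)) key
    nlinarith [hs.1]
  have key3 : ((kk m : ℝ) - bet * m) ^ 2 ≤ 20 * m := by
    by_contra hc
    push Not at hc
    nlinarith
  apply abs_le_of_sq_le_sq _ (by positivity)
  nlinarith



/-- Coloured graph as 0/1 matrices, with blue diagonal. -/
structure CG (V : Type) where
  R : V → V → ℝ
  B : V → V → ℝ
  R01 : ∀ x y, R x y = 0 ∨ R x y = 1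
  B01 : ∀ x y, B x y = 0 ∨ B x y = 1
  Bsymm : ∀ x y, B x y = B y x
  Bdiag : ∀ x, B x x = 1
  tri : ∀ x y, B x y + R x y + R y x = 1

namespace CG

theorem Rdiag {V : Type} (g : CG V) (x : V) : g.R x x = 0 := by
  have := g.tri x x; rw [g.Bdiag] at this; linarith

theorem R_nonneg {V : Type} (g : CG V) (x y : V) : 0 ≤ g.R x y := by
  rcases g.R01 x y with h | h <;> rw [h] <;> norm_num

theorem R_le {V : Type} (g : CG V) (x y : V) : g.R x y ≤ 1 := by
  rcases g.R01 x y with h | h <;> rw [h] <;> norm_num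

theorem B_nonneg {V : Type} (g : CG V) (x y : V) : 0 ≤ g.B x y := by
  rcases g.B01 x y with h | h <;> rw [h] <;> norm_num

theorem B_le {V : Type} (g : CG V) (x y : V) : g.B x y ≤ 1 := by
  rcases g.B01 x y with h | h <;> rw [h] <;> norm_num

theorem R_sq {V : Type} (g : CG V) (x y : V) : g.R x y * g.R x y = g.R x y := by
  rcases g.R01 x y with h | h <;> rw [h] <;> norm_num

theorem R_of_B {V : Type} (g : CG V) {x y : V} (h : g.B x y = 1) : g.R x y = 0 := by
  have := g.tri x y; have := g.R_nonneg x y; have := g.R_nonneg y x; linarith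

section
variable {V : Type} [Fintype V] (g : CG V)

/-- The weighted trilinear form. -/
noncomputable def T (a b c : V → ℝ) : ℝ :=
  ∑ x, ∑ y, ∑ z, a x * b y * c z * (g.R x y * g.R x z * g.B y z)

/-- The weighted red bilinear form. -/
noncomputable def S (a b : V → ℝ) : ℝ := ∑ x, ∑ y, a x * b y * g.R x y

theorem T_comm (a b c : V → ℝ) : g.T a b c = g.T a c b := by
  unfold T
  refine Finset.sum_congr rfl fun x _ => ?_
  rw [Finset.sum_comm]
  refine Finset.sum_congr rfl fun z _ => Finset.sum_congr rfl fun y _ => ?_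
  rw [g.Bsymm y z]; ring

theorem T_add1 (a d b c : V → ℝ) (s : ℝ) :
    g.T (fun x => a x + s * d x) b c = g.T a b c + s * g.T d b c := by
  simp only [T, Finset.mul_sum, ← Finset.sum_add_distrib]
  refine Finset.sum_congr rfl fun x _ => Finset.sum_congr rfl fun y _ =>
    Finset.sum_congr rfl fun z _ => by ring

theorem T_add2 (a d b c : V → ℝ) (s : ℝ) :
    g.T b (fun x => a x + s * d x) c = g.T b a c + s * g.T b d c := by
  simp only [T, Finset.mul_sum, ← Finset.sum_add_distrib]
  refine Finset.sum_congr rfl fun x _ => Finset.sum_congr rfl fun y _ =>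
    Finset.sum_congr rfl fun z _ => by ring

theorem T_add3 (a d b c : V → ℝ) (s : ℝ) :
    g.T b c (fun x => a x + s * d x) = g.T b c a + s * g.T b c d := by
  rw [T_comm, T_add2, T_comm, T_comm g b d]

theorem T_expand (w d : V → ℝ) (s : ℝ) :
    g.T (fun x => w x + s * d x) (fun x => w x + s * d x) (fun x => w x + s * d x) =
    g.T w w w + s * (g.T d w w + 2 * g.T w d w) + s ^ 2 * (2 * g.T d d w + g.T w d d)
      + s ^ 3 * g.T d d d := by
  rw [T_add1, T_add2, T_add2, T_add3, T_add3, T_add3, T_add3]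
  rw [T_comm g w w d, T_comm g d w d]
  ring

theorem S_expand (w d : V → ℝ) (s : ℝ) :
    g.S (fun x => w x + s * d x) (fun x => w x + s * d x) =
    g.S w w + s * (g.S d w + g.S w d) + s ^ 2 * g.S d d := by
  simp only [S, Finset.mul_sum, ← Finset.sum_add_distrib]
  refine Finset.sum_congr rfl fun x _ => Finset.sum_congr rfl fun y _ => by ring

theorem T_mono (a b c : V → ℝ) (ha : ∀ x, 0 ≤ a x) (hb : ∀ x, 0 ≤ b x) (hc : ∀ x, 0 ≤ c x) :
    0 ≤ g.T a b c := by
  unfold T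
  refine Finset.sum_nonneg fun x _ => Finset.sum_nonneg fun y _ => Finset.sum_nonneg fun z _ => ?_
  have := g.R_nonneg x y
  have := g.R_nonneg x z
  have := g.B_nonneg y z
  have := ha x
  have := hb y
  have := hc z
  positivity

theorem S_le (a : V → ℝ) (ha : ∀ x, 0 ≤ a x) : g.S a a ≤ (∑ x, a x) ^ 2 := by
  rw [sq, Finset.sum_mul_sum]
  unfold S
  refine Finset.sum_le_sum fun x _ => Finset.sum_le_sum fun y _ => ?_
  have := mul_nonneg (ha x) (ha y)
  nlinarith [g.R_le x y]

theorem T_zero_of (d c : V → ℝ) (h : ∀ a b, d a * d b * g.R a b = 0) : g.T d d c = 0 := by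
  unfold T
  refine Finset.sum_eq_zero fun x _ => Finset.sum_eq_zero fun y _ => Finset.sum_eq_zero fun z _ => ?_
  have : d x * d y * c z * (g.R x y * g.R x z * g.B y z)
      = (d x * d y * g.R x y) * (c z * g.R x z * g.B y z) := by ring
  rw [this, h, zero_mul]

theorem T_sq_of (w d : V → ℝ) (h : ∀ a b, d a * d b * g.B a b = d a * d b) :
    g.T w d d = ∑ x, w x * (∑ y, d y * g.R x y) ^ 2 := by
  unfold T
  refine Finset.sum_congr rfl fun x _ => ?_
  rw [sq, Finset.sum_mul_sum, Finset.mul_sum]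
  refine Finset.sum_congr rfl fun y _ => ?_
  rw [Finset.mul_sum]
  refine Finset.sum_congr rfl fun z _ => ?_
  linear_combination w x * g.R x y * g.R x z * h y z

end

section
variable {V : Type} [Fintype V] [DecidableEq V] (g : CG V)

set_option maxHeartbeats 1000000 in
theorem upper_aux (c : ℕ) : ∀ w : V → ℕ, (Finset.univ.filter fun x => w x ≠ 0).card = c →
    g.T (fun x => (w x : ℝ)) (fun x => (w x : ℝ)) (fun x => (w x : ℝ))
      - g.S (fun x => (w x : ℝ)) (fun x => (w x : ℝ)) ≤ 2 * (f (∑ x, w x) : ℝ) := by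
  induction c using Nat.strong_induction_on with
  | _ c ih =>
  intro w hc
  set W : V → ℝ := fun x => (w x : ℝ) with hW
  have hW0 : ∀ x, 0 ≤ W x := fun x => by simp [hW]
  by_cases hb : ∃ x y, x ≠ y ∧ w x ≠ 0 ∧ w y ≠ 0 ∧ g.B x y = 1
  · obtain ⟨x, y, hxy, hx, hy, hB⟩ := hb
    set d : V → ℝ := fun z => (if z = x then 1 else 0) - (if z = y then 1 else 0) with hd
    have hB' : g.B y x = 1 := by rw [g.Bsymm]; exact hB
    have dR : ∀ a b, d a * d b * g.R a b = 0 := by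
      intro a b
      have r1 := g.R_of_B hB
      have r2 := g.R_of_B hB'
      have r3 := g.Rdiag x
      have r4 := g.Rdiag y
      simp only [hd]
      split_ifs <;> subst_vars <;> simp_all
    have dB : ∀ a b, d a * d b * g.B a b = d a * d b := by
      intro a b
      have r3 := g.Bdiag x
      have r4 := g.Bdiag y
      simp only [hd]
      split_ifs <;> subst_vars <;> simp_all
    have hS : g.S d d = 0 := by
      unfold S
      exact Finset.sum_eq_zero fun a _ => Finset.sum_eq_zero fun b _ => dR a b
    have hq : 0 ≤ g.T W d d := by
      rw [g.T_sq_of W d dB]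
      exact Finset.sum_nonneg fun a _ => mul_nonneg (hW0 a) (sq_nonneg _)
    have hsd : ∑ z, d z = 0 := by simp [hd]
    -- a general step
    have step : ∀ (w' : V → ℕ) (s : ℝ) (y' : V), w y' ≠ 0 → w' y' = 0 →
        (∀ z, w' z ≠ 0 → w z ≠ 0) →
        (fun z => (w' z : ℝ)) = (fun z => W z + s * d z) →
        g.T W W W - g.S W W + s * (g.T d W W + 2 * g.T W d W - (g.S d W + g.S W d))
          ≤ 2 * (f (∑ x, w x) : ℝ) := by
      intro w' s y' h1 h2 h3 h4
      have hlt : (Finset.univ.filter fun x => w' x ≠ 0).card < c := by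
        rw [← hc]
        apply Finset.card_lt_card
        refine ⟨fun z hz => ?_, fun hh => ?_⟩
        · simp only [Finset.mem_filter, Finset.mem_univ, true_and] at hz ⊢
          exact h3 z hz
        · have := hh (show y' ∈ _ by simp [h1])
          simp [h2] at this
      have hsum : ∑ x, w' x = ∑ x, w x := by
        have : (∑ x, (w' x : ℝ)) = ∑ x, (w x : ℝ) := by
          have e := congrArg (fun F : V → ℝ => ∑ z, F z) h4
          simp only [Finset.sum_add_distrib, ← Finset.mul_sum, hsd] at e
          rw [e]; simp [hW]
        exact_mod_cast this
      have := ih _ hlt w' rfl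
      rw [h4, g.T_expand, g.S_expand, g.T_zero_of d W dR, g.T_zero_of d d dR, hS, hsum] at this
      nlinarith [mul_nonneg (sq_nonneg s) hq]
    rcases le_total 0 (g.T d W W + 2 * g.T W d W - (g.S d W + g.S W d)) with hl | hl
    · have := step (fun z => if z = x then w x + w y else if z = y then 0 else w z) (w y) y hy
        (by simp [hxy.symm]) (by
          intro z hz
          by_cases h1 : z = x
          · rw [h1]; exact hx
          · by_cases h2 : z = y
            · rw [h2]; exact hy
            · simpa [h1, h2] using hz) (by
          funext z
          by_cases h1 : z = x
          · subst h1; simp [hd, hW, hxy]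
          · by_cases h2 : z = y
            · subst h2; simp [hd, hW, h1]
            · simp [hd, hW, h1, h2])
      nlinarith [mul_nonneg (Nat.cast_nonneg (α := ℝ) (w y)) hl]
    · have := step (fun z => if z = y then w x + w y else if z = x then 0 else w z) (-(w x)) x hx
        (by simp [hxy]) (by
          intro z hz
          by_cases h1 : z = x
          · rw [h1]; exact hx
          · by_cases h2 : z = y
            · rw [h2]; exact hy
            · simpa [h1, h2] using hz) (by
          funext z
          by_cases h1 : z = x
          · subst h1; simp [hd, hW, hxy]
          · by_cases h2 : z = y
            · subst h2; simp [hd, hW, h1]; ring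
            · simp [hd, hW, h1, h2])
      nlinarith [mul_nonneg (Nat.cast_nonneg (α := ℝ) (w x)) (neg_nonneg.2 hl)]
  · push Not at hb
    by_cases hne : ∃ x, w x ≠ 0
    swap
    · push Not at hne
      have : W = fun _ => 0 := by funext x; simp [hW, hne x]
      rw [this]
      simp [T, S]
    obtain ⟨x₀, hx₀⟩ := hne
    obtain ⟨m, -, hm⟩ := Finset.exists_max_image Finset.univ w ⟨x₀, Finset.mem_univ _⟩
    have hm0 : w m ≠ 0 := by
      have := hm x₀ (Finset.mem_univ _); omega
    have bz : ∀ x y, x ≠ y → W x * W y * g.B x y = 0 := by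
      intro x y hxy
      by_cases h1 : w x = 0
      · simp [hW, h1]
      by_cases h2 : w y = 0
      · simp [hW, h2]
      rcases g.B01 x y with h | h
      · rw [h, mul_zero]
      · exact absurd h (hb x y hxy h1 h2)
    set w' : V → ℕ := fun z => if z = m then 0 else w z with hw'
    set W' : V → ℝ := fun z => (w' z : ℝ) with hW'
    set e : V → ℝ := fun z => if z = m then 1 else 0 with he
    have hWe : W = fun z => W' z + (w m : ℝ) * e z := by
      funext z
      by_cases h1 : z = m
      · subst h1; simp [hW, hW', hw', he]
      · simp [hW, hW', hw', he, h1]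
    have W'm : W' m = 0 := by simp [hW', hw']
    have W'le : ∀ z, W' z ≤ W z := by
      intro z; by_cases h1 : z = m <;> simp [hW', hw', hW, h1]
    have W'0 : ∀ z, 0 ≤ W' z := fun z => by simp [hW']
    have bz' : ∀ x y, x ≠ y → W' x * W' y * g.B x y = 0 := by
      intro x y hxy
      by_cases h1 : x = m
      · simp [h1, W'm]
      by_cases h2 : y = m
      · simp [h2, W'm]
      have := bz x y hxy
      simpa [hW', hw', hW, h1, h2] using this
    have bm : ∀ x, W' x * g.B m x = 0 := by
      intro x
      by_cases h1 : x = m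
      · simp [h1, W'm]
      have := bz m x (Ne.symm h1)
      have h2 : W m ≠ 0 := by simp [hW, hm0]
      have h3 : W x * g.B m x = 0 := by
        have : W m * (W x * g.B m x) = 0 := by rw [← this]; ring
        exact (mul_eq_zero.1 this).resolve_left h2
      simpa [hW', hw', hW, h1] using h3
    have t1 : g.T e W' W' = ∑ y, W' y ^ 2 * g.R m y := by
      unfold T
      rw [Finset.sum_eq_single m (by intro b _ hb; simp [he, hb]) (by simp)]
      refine Finset.sum_congr rfl fun y _ => ?_
      rw [Finset.sum_eq_single y]
      · rw [g.Bdiag]; simp only [he, if_true]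
        linear_combination W' y * W' y * g.R_sq m y
      · intro z _ hz
        have := bz' y z (Ne.symm hz)
        linear_combination e m * g.R m y * g.R m z * this
      · simp
    have t2 : g.T W' e W' = 0 := by
      unfold T
      refine Finset.sum_eq_zero fun x _ => Finset.sum_eq_zero fun y _ =>
        Finset.sum_eq_zero fun z _ => ?_
      by_cases h1 : y = m
      · subst h1
        linear_combination W' x * e y * g.R x y * g.R x z * bm z
      · simp [he, h1]
    have eR : ∀ a b, e a * e b * g.R a b = 0 := by
      intro a b
      have := g.Rdiag m
      simp only [he]; split_ifs <;> subst_vars <;> simp_all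
    have eB : ∀ a b, e a * e b * g.B a b = e a * e b := by
      intro a b
      have := g.Bdiag m
      simp only [he]; split_ifs <;> subst_vars <;> simp_all
    have t3 := g.T_zero_of e W' eR
    have t3' := g.T_zero_of e e eR
    have t4 : g.T W' e e = ∑ x, W' x * g.R x m := by
      rw [g.T_sq_of W' e eB]
      refine Finset.sum_congr rfl fun x _ => ?_
      have : ∑ y, e y * g.R x y = g.R x m := by simp [he]
      rw [this, sq, g.R_sq]
    have s1 : g.S e W' = ∑ y, W' y * g.R m y := by
      unfold S
      rw [Finset.sum_eq_single m (by intro b _ hb; simp [he, hb]) (by simp)]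
      simp [he]
    have s2 : g.S W' e = ∑ x, W' x * g.R x m := by
      unfold S
      refine Finset.sum_congr rfl fun x _ => ?_
      simp [he]
    have s3 : g.S e e = 0 := by
      unfold S
      exact Finset.sum_eq_zero fun a _ => Finset.sum_eq_zero fun b _ => eR a b
    have hlt : (Finset.univ.filter fun x => w' x ≠ 0).card < c := by
      rw [← hc]
      apply Finset.card_lt_card
      refine ⟨fun z hz => ?_, fun hh => ?_⟩
      · simp only [Finset.mem_filter, Finset.mem_univ, true_and, hw'] at hz ⊢
        intro h; apply hz; simp [h]
      · have := hh (show m ∈ _ by simp [hm0])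
        simp [hw'] at this
    have i := ih _ hlt w' rfl
    have sumw : ∑ x, w x = ∑ x, w' x + w m := by
      rw [← Finset.add_sum_erase Finset.univ w (Finset.mem_univ m),
        ← Finset.add_sum_erase Finset.univ w' (Finset.mem_univ m)]
      have : ∑ x ∈ Finset.univ.erase m, w' x = ∑ x ∈ Finset.univ.erase m, w x := by
        refine Finset.sum_congr rfl fun x hx => ?_
        simp [hw', (Finset.mem_erase.1 hx).1]
      rw [this]; simp [hw']; ring
    have fg := f_ge (∑ x, w x) (w m) (by omega) (by omega)
    have fg' : (((w m).choose 2 : ℕ) : ℝ) * (∑ x, W' x) + f (∑ x, w' x) ≤ f (∑ x, w x) := by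
      rw [show (∑ x, w x) - w m = ∑ x, w' x by omega] at fg
      simp only [hW']
      exact_mod_cast fg
    rw [choose_two_real] at fg'
    rw [hWe, g.T_expand, g.S_expand, t1, t2, t3, t3', t4, s1, s2, s3]
    have main : (w m : ℝ) * (∑ y, W' y ^ 2 * g.R m y) + (w m : ℝ) ^ 2 * ∑ x, W' x * g.R x m
        - (w m : ℝ) * (∑ y, W' y * g.R m y + ∑ x, W' x * g.R x m)
        ≤ (w m : ℝ) * (w m - 1) * ∑ x, W' x := by
      simp only [mul_add, Finset.mul_sum, ← Finset.sum_add_distrib, ← Finset.sum_sub_distrib]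
      refine Finset.sum_le_sum fun y _ => ?_
      have a0 := W'0 y
      have a1 : W' y ≤ w m := by
        refine (W'le y).trans ?_
        simp only [hW]; exact_mod_cast hm y (Finset.mem_univ _)
      have a2 := g.tri m y
      have a3 := g.B_nonneg m y
      have a4 := g.R_nonneg m y
      have a5 := g.R_nonneg y m
      have a6 : (1 : ℝ) ≤ w m := by exact_mod_cast (by omega : 1 ≤ w m)
      have b1 : (w m : ℝ) * W' y * (W' y * g.R m y) ≤ (w m : ℝ) * W' y * (w m * g.R m y) := by
        gcongr
      have b2 : (w m : ℝ) * W' y * (w m - 1) * (g.R m y + g.R y m)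
          ≤ (w m : ℝ) * W' y * (w m - 1) * 1 := by
        apply mul_le_mul_of_nonneg_left (by linarith)
        have : (0 : ℝ) ≤ w m - 1 := by linarith
        positivity
      linarith
    have hWfold : (fun x => (w' x : ℝ)) = W' := rfl
    rw [hWfold] at i
    linarith

theorem upper (w : V → ℕ) : g.T (fun x => (w x : ℝ)) (fun x => (w x : ℝ)) (fun x => (w x : ℝ))
    ≤ tau * (∑ x, (w x : ℝ)) ^ 3 + (∑ x, (w x : ℝ)) ^ 2 := by
  have h1 := g.upper_aux _ w rfl
  have h2 := g.S_le (fun x => (w x : ℝ)) (fun x => by positivity)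
  have h3 := f_le (∑ x, w x)
  push_cast at h3
  linarith

end

end CG


namespace CG

section
variable {V : Type} [Fintype V] (g : CG V)

def Near (ε : ℝ) : Prop :=
  (tau - ε) * (Fintype.card V : ℝ) ^ 3 ≤ g.T (fun _ => 1) (fun _ => 1) (fun _ => 1) ∧
    1 ≤ ε * (Fintype.card V : ℝ)

theorem Near.mono {g : CG V} {ε ε' : ℝ} (h : g.Near ε) (hε : ε ≤ ε') : g.Near ε' := by
  obtain ⟨h1, h2⟩ := h
  have h0 : (0 : ℝ) ≤ (Fintype.card V : ℝ) := by positivity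
  refine ⟨le_trans ?_ h1, le_trans h2 ?_⟩
  · gcongr
  · gcongr

noncomputable def deg (x : V) : ℝ := ∑ y, ∑ z, g.R x y * g.R x z * g.B y z +
  2 * ∑ y, ∑ z, g.R y x * g.R y z * g.B x z

theorem T_lin (u : V → ℝ) : 2 * g.T (fun _ => 1) (fun _ => 1) u + g.T u (fun _ => 1) (fun _ => 1)
    = ∑ x, u x * g.deg x := by
  rw [T_comm]
  have h1 : g.T (fun _ => 1) u (fun _ => 1) = ∑ x, u x * ∑ y, ∑ z, g.R y x * g.R y z * g.B x z := by
    unfold T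
    rw [Finset.sum_comm]
    refine Finset.sum_congr rfl fun x _ => ?_
    simp only [Finset.mul_sum]
    refine Finset.sum_congr rfl fun y _ => Finset.sum_congr rfl fun z _ => by ring
  have h2 : g.T u (fun _ => 1) (fun _ => 1) = ∑ x, u x * ∑ y, ∑ z, g.R x y * g.R x z * g.B y z := by
    unfold T
    refine Finset.sum_congr rfl fun x _ => ?_
    simp only [Finset.mul_sum]
    refine Finset.sum_congr rfl fun y _ => Finset.sum_congr rfl fun z _ => by ring
  rw [h1, h2, Finset.mul_sum, ← Finset.sum_add_distrib]
  refine Finset.sum_congr rfl fun x _ => ?_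
  unfold deg; ring

theorem sum_deg : ∑ x, g.deg x = 3 * g.T (fun _ => 1) (fun _ => 1) (fun _ => 1) := by
  have := g.T_lin (fun _ => 1)
  simp only [one_mul] at this
  rw [← this]; ring

end

section
variable {V : Type} [Fintype V] [DecidableEq V] (g : CG V)

theorem perturb (k : ℕ) (u : V → ℝ) (w : V → ℕ) (h : ∀ x, (w x : ℝ) = u x + k * 1) :
    g.T u u u + k * (g.T (fun _ => 1) u u + 2 * g.T u u (fun _ => 1)) +
      (k : ℝ) ^ 2 * (∑ x, u x * g.deg x) +
      (k : ℝ) ^ 3 * g.T (fun _ => 1) (fun _ => 1) (fun _ => 1) ≤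
    tau * ((∑ x, u x) + k * (Fintype.card V : ℝ)) ^ 3 +
      ((∑ x, u x) + k * (Fintype.card V : ℝ)) ^ 2 := by
  have hu := g.upper w
  have hs : ∑ x, (w x : ℝ) = (∑ x, u x) + k * (Fintype.card V : ℝ) := by
    simp only [h, Finset.sum_add_distrib]
    simp [mul_comm]
  have hf : (fun x => (w x : ℝ)) = fun x => u x + (k : ℝ) * (fun _ => (1 : ℝ)) x := by
    funext x; exact h x
  rw [hs, hf, g.T_expand, g.T_lin, g.T_comm u (fun _ => 1) u] at hu
  linarith

end

theorem deg_upper (η : ℝ) (hη : 0 < η) : ∃ ε : ℝ, 0 < ε ∧ ∀ (V : Type) [Fintype V] [DecidableEq V]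
    (g : CG V), g.Near ε → ∀ x, g.deg x ≤ (3 * tau + η) * (Fintype.card V : ℝ) ^ 2 := by
  obtain ⟨k, hk⟩ := exists_nat_gt (max 1 (2 / η))
  have k1 : (1 : ℝ) < k := (le_max_left _ _).trans_lt hk
  have k2 : 2 / η < k := (le_max_right _ _).trans_lt hk
  rw [div_lt_iff₀ hη] at k2
  refine ⟨η / (2 * (k + 4)), by positivity, fun V _ _ g hg v => ?_⟩
  set ε := η / (2 * (k + 4)) with hε
  have hεk : 2 * ε * (k + 4) = η := by rw [hε]; field_simp
  have hε0 : 0 < ε := by rw [hε]; positivity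
  obtain ⟨h1, h2⟩ := hg
  set n : ℝ := (Fintype.card V : ℝ) with hn
  have hn0 : 0 < n := by
    by_contra hc
    push Not at hc
    nlinarith
  have p := g.perturb k (fun x => n * if x = v then 1 else 0)
    (fun x => k + Fintype.card V * if x = v then 1 else 0) (by
      intro x; push_cast; rw [hn]; ring)
  have hu0 : ∀ x, 0 ≤ n * (if x = v then (1 : ℝ) else 0) := by
    intro x; positivity
  have p1 := g.T_mono (fun x => n * if x = v then 1 else 0) (fun x => n * if x = v then 1 else 0)
    (fun x => n * if x = v then 1 else 0) hu0 hu0 hu0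
  have p2 := g.T_mono (fun _ => 1) (fun x => n * if x = v then 1 else 0)
    (fun x => n * if x = v then 1 else 0) (by simp) hu0 hu0
  have p3 := g.T_mono (fun x => n * if x = v then 1 else 0) (fun x => n * if x = v then 1 else 0)
    (fun _ => 1) hu0 hu0 (by simp)
  have e1 : ∑ x, (n * (if x = v then (1 : ℝ) else 0)) = n := by simp
  have e2 : ∑ x, (n * (if x = v then (1 : ℝ) else 0)) * g.deg x = n * g.deg v := by simp
  rw [e1, e2] at p
  have ht := tau_bounds
  have hk0 : (0 : ℝ) < k := by linarith
  have q : (k : ℝ) ^ 2 * (n * g.deg v) + k ^ 3 * ((tau - ε) * n ^ 3)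
      ≤ tau * (n + k * n) ^ 3 + (n + k * n) ^ 2 := by
    have a := mul_le_mul_of_nonneg_left h1 (by positivity : (0 : ℝ) ≤ (k : ℝ) ^ 3)
    have b := mul_nonneg hk0.le (add_nonneg p2 (mul_nonneg (by norm_num : (0 : ℝ) ≤ 2) p3))
    linarith
  by_contra hc
  push Not at hc
  have hc' := mul_lt_mul_of_pos_left hc (by positivity : (0 : ℝ) < (k : ℝ) ^ 2 * n)
  -- bounds
  have b1 : (n + k * n) ^ 2 ≤ 4 * k ^ 2 * ε * n ^ 3 := by
    have : n + k * n ≤ 2 * k * n := by nlinarith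
    calc (n + k * n) ^ 2 ≤ (2 * k * n) ^ 2 := by gcongr
      _ = 4 * k ^ 2 * n ^ 2 * 1 := by ring
      _ ≤ 4 * k ^ 2 * n ^ 2 * (ε * n) := by gcongr
      _ = _ := by ring
  have b2 : tau * (3 * k + 1) ≤ k := by nlinarith
  have b3 : tau * (3 * k + 1) * n ^ 3 ≤ k * n ^ 3 := by gcongr
  have b4 : 2 * (k * n ^ 3) ≤ (k * η) * (k * n ^ 3) := by gcongr
  have b5 : 2 * ε * (k + 4) * (k ^ 2 * n ^ 3) = η * (k ^ 2 * n ^ 3) := by rw [hεk]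
  nlinarith

/-- layered blow-up -/
noncomputable def lay {V : Type} (g g' : CG V) (k : ℕ) : CG (V × Fin k) where
  R p q := if p.2 = q.2 then g'.R p.1 q.1 else g.R p.1 q.1
  B p q := if p.2 = q.2 then g'.B p.1 q.1 else g.B p.1 q.1
  R01 p q := by split_ifs; exacts [g'.R01 _ _, g.R01 _ _]
  B01 p q := by split_ifs; exacts [g'.B01 _ _, g.B01 _ _]
  Bsymm p q := by
    simp only [eq_comm (a := p.2)]
    rw [g'.Bsymm, g.Bsymm]
  Bdiag p := by simp [g'.Bdiag]
  tri p q := by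
    simp only [eq_comm (a := q.2)]
    split_ifs
    exacts [g'.tri _ _, g.tri _ _]

theorem sum_delta {k : ℕ} (i j : Fin k) (q q' s s' : ℝ) :
    ∑ l : Fin k, (if i = l then q' else q) * (if j = l then s' else s) =
      k * (q * s) + q * (s' - s) + (q' - q) * s + if i = j then (q' - q) * (s' - s) else 0 := by
  have : ∀ l : Fin k, (if i = l then q' else q) * (if j = l then s' else s) =
      q * s + (if j = l then q * (s' - s) else 0) + (if i = l then (q' - q) * s else 0) +
        (if i = l then (if i = j then (q' - q) * (s' - s) else 0) else 0) := by
    intro l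
    split_ifs <;> first | ring1 | (exfalso; grind)
  simp only [this, Finset.sum_add_distrib]
  simp

theorem sum_delta3 {k : ℕ} (p p' q q' s s' : ℝ) :
    ∑ i : Fin k, ∑ j : Fin k, ∑ l : Fin k, (if i = j then p' else p) * (if i = l then q' else q) *
      (if j = l then s' else s) = k ^ 3 * (p * q * s) +
      k ^ 2 * ((p' - p) * q * s + p * (q' - q) * s + p * q * (s' - s)) +
      k * (p * (q' - q) * (s' - s) + (p' - p) * q * (s' - s) + (p' - p) * (q' - q) * s
        + (p' - p) * (q' - q) * (s' - s)) := by
  simp only [mul_assoc, ← Finset.mul_sum, sum_delta]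
  have : ∀ i j : Fin k, (if i = j then p' else p) * (k * (q * s) + (q * (s' - s) + (q' - q) * s) +
      if i = j then (q' - q) * (s' - s) else 0) =
      p * (k * (q * s) + (q * (s' - s) + (q' - q) * s)) +
      if i = j then p * ((q' - q) * (s' - s)) +
        (p' - p) * (k * (q * s) + (q * (s' - s) + (q' - q) * s) + (q' - q) * (s' - s)) else 0 := by
    intro i j; split_ifs <;> ring
  simp only [add_assoc] at this
  simp only [add_assoc, this, Finset.sum_add_distrib]
  simp
  ring

section
variable {V : Type} [Fintype V] [DecidableEq V]

noncomputable def Dv (g g' : CG V) : ℝ := ∑ x, ∑ y, ∑ z,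
  ((g'.R x y - g.R x y) * g.R x z * g.B y z + g.R x y * (g'.R x z - g.R x z) * g.B y z +
    g.R x y * g.R x z * (g'.B y z - g.B y z))

theorem sum_const3 (V : Type) [Fintype V] (c : ℝ) :
    ∑ _x : V, ∑ _y : V, ∑ _z : V, c = c * (Fintype.card V : ℝ) ^ 3 := by
  simp; ring

theorem lay_T (g g' : CG V) (k : ℕ) :
    (k : ℝ) ^ 3 * g.T (fun _ => 1) (fun _ => 1) (fun _ => 1) + (k : ℝ) ^ 2 * Dv g g'
      - 4 * k * (Fintype.card V : ℝ) ^ 3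
      ≤ (lay g g' k).T (fun _ => 1) (fun _ => 1) (fun _ => 1) := by
  have e : (lay g g' k).T (fun _ => 1) (fun _ => 1) (fun _ => 1) =
      ∑ x, ∑ y, ∑ z, ∑ i : Fin k, ∑ j : Fin k, ∑ l : Fin k,
        (if i = j then g'.R x y else g.R x y) * (if i = l then g'.R x z else g.R x z) *
      (if j = l then g'.B y z else g.B y z) := by
    unfold T
    simp only [Fintype.sum_prod_type, lay, one_mul]
    refine Finset.sum_congr rfl fun x _ => ?_
    rw [Finset.sum_comm]
    refine Finset.sum_congr rfl fun y _ => ?_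
    rw [Finset.sum_comm' (t' := Finset.univ) (s' := fun _ => Finset.univ) (by simp)]
    have : ∀ j : Fin k, ∀ i : Fin k, ∑ z : V, ∑ l : Fin k,
        (if i = j then g'.R x y else g.R x y) * (if i = l then g'.R x z else g.R x z) *
        (if j = l then g'.B y z else g.B y z) = ∑ z : V, ∑ l : Fin k,
        (if i = j then g'.R x y else g.R x y) * (if i = l then g'.R x z else g.R x z) *
        (if j = l then g'.B y z else g.B y z) := fun _ _ => rfl
    rw [Finset.sum_comm]
    have h2 : ∀ i : Fin k, ∑ j : Fin k, ∑ z : V, ∑ l : Fin k,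
        (if i = j then g'.R x y else g.R x y) * (if i = l then g'.R x z else g.R x z) *
        (if j = l then g'.B y z else g.B y z) = ∑ z : V, ∑ j : Fin k, ∑ l : Fin k,
        (if i = j then g'.R x y else g.R x y) * (if i = l then g'.R x z else g.R x z) *
        (if j = l then g'.B y z else g.B y z) := fun i => Finset.sum_comm
    simp only [h2]
    rw [Finset.sum_comm]
  rw [e]
  simp only [sum_delta3]
  unfold T Dv
  rw [← sum_const3 V (4 * (k : ℝ)), Finset.mul_sum, Finset.mul_sum]
  simp only [Finset.mul_sum, ← Finset.sum_add_distrib, ← Finset.sum_sub_distrib]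
  refine Finset.sum_le_sum fun x _ => Finset.sum_le_sum fun y _ => Finset.sum_le_sum fun z _ => ?_
  have key : -4 ≤ (g.R x y * (g'.R x z - g.R x z) * (g'.B y z - g.B y z) +
      (g'.R x y - g.R x y) * g.R x z * (g'.B y z - g.B y z) +
      (g'.R x y - g.R x y) * (g'.R x z - g.R x z) * g.B y z
        + (g'.R x y - g.R x y) * (g'.R x z - g.R x z) * (g'.B y z - g.B y z)) := by
    rcases g.R01 x y with h1 | h1 <;> rcases g.R01 x z with h2 | h2 <;>
    rcases g.B01 y z with h3 | h3 <;> rcases g'.R01 x y with h4 | h4 <;>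
    rcases g'.R01 x z with h5 | h5 <;> rcases g'.B01 y z with h6 | h6 <;>
    rw [h1, h2, h3, h4, h5, h6] <;> norm_num
  have := mul_le_mul_of_nonneg_left key (by positivity : (0 : ℝ) ≤ k)
  linarith

end

theorem edge_opt (η : ℝ) (hη : 0 < η) : ∃ ε : ℝ, 0 < ε ∧ ∀ (V : Type) [Fintype V] [DecidableEq V]
    (g : CG V), g.Near ε → ∀ g' : CG V, Dv g g' ≤ η * (Fintype.card V : ℝ) ^ 3 := by
  obtain ⟨k, hk⟩ := exists_nat_gt (max 1 (8 / η))
  have k1 : (1 : ℝ) < k := (le_max_left _ _).trans_lt hk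
  have k2 : 8 / η < k := (le_max_right _ _).trans_lt hk
  rw [div_lt_iff₀ hη] at k2
  refine ⟨η / (2 * (k + 1)), by positivity, fun V _ _ g hg g' => ?_⟩
  set ε := η / (2 * (k + 1)) with hε
  have hεk : 2 * ε * (k + 1) = η := by rw [hε]; field_simp
  have hε0 : 0 < ε := by rw [hε]; positivity
  obtain ⟨h1, h2⟩ := hg
  have a := lay_T g g' k
  have b := (lay g g' k).upper (fun _ => 1)
  simp only [Nat.cast_one, Finset.sum_const, Finset.card_univ, Fintype.card_prod, Fintype.card_fin,
    nsmul_eq_mul, mul_one, Nat.cast_mul] at b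
  set n : ℝ := (Fintype.card V : ℝ) with hn
  have hn0 : 0 < n := by
    by_contra hc
    push Not at hc
    nlinarith
  have hk0 : (0 : ℝ) < k := by linarith
  by_contra hc
  push Not at hc
  have c1 := mul_lt_mul_of_pos_left hc (by positivity : (0 : ℝ) < (k : ℝ) ^ 2)
  have c2 := mul_le_mul_of_nonneg_left h1 (by positivity : (0 : ℝ) ≤ (k : ℝ) ^ 3)
  have c3 : (n * k) ^ 2 * 1 ≤ (n * k) ^ 2 * (ε * n) := by gcongr
  have c4 : 8 * (k * n ^ 3) ≤ (k * η) * (k * n ^ 3) := by gcongr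
  have c5 : 2 * ε * (k + 1) * (k ^ 2 * n ^ 3) = η * (k ^ 2 * n ^ 3) := by rw [hεk]
  nlinarith

end CG


namespace CG

section
variable {V : Type} [Fintype V] [DecidableEq V] (g : CG V)

noncomputable def q (v : V) : ℝ := ∑ x, g.B v x

noncomputable def mz (v z : V) : ℝ := ∑ x, g.B v x * g.R z x

noncomputable def bad1 (v : V) : ℝ := ∑ z, (g.q v * g.R z v - g.mz v z) ^ 2

open Classical in
theorem q_nat (v : V) : ((Finset.univ.filter fun x => g.B v x = 1).card : ℝ) = g.q v := by
  unfold q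
  rw [Finset.card_filter]
  push_cast
  refine Finset.sum_congr rfl fun x _ => ?_
  rcases g.B01 v x with h | h <;> simp [h]

theorem q_nonneg (v : V) : 0 ≤ g.q v := Finset.sum_nonneg fun x _ => g.B_nonneg v x

theorem q_le (v : V) : g.q v ≤ Fintype.card V := by
  unfold q
  calc ∑ x, g.B v x ≤ ∑ _x : V, (1 : ℝ) := Finset.sum_le_sum fun x _ => g.B_le v x
    _ = _ := by simp

/-- the set `A_v` made blue -/
noncomputable def mkBlue (v : V) : CG V where
  R x y := g.R x y * (1 - g.B v x * g.B v y)
  B x y := g.B x y + (1 - g.B x y) * (g.B v x * g.B v y)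
  R01 x y := by
    rcases g.R01 x y with h | h <;> rcases g.B01 v x with h1 | h1 <;>
    rcases g.B01 v y with h2 | h2 <;> simp [h, h1, h2]
  B01 x y := by
    rcases g.B01 x y with h | h <;> rcases g.B01 v x with h1 | h1 <;>
    rcases g.B01 v y with h2 | h2 <;> simp [h, h1, h2]
  Bsymm x y := by rw [g.Bsymm x y]; ring
  Bdiag x := by rw [g.Bdiag]; ring
  tri x y := by
    linear_combination (1 - g.B v x * g.B v y) * g.tri x y

noncomputable def uu (v x : V) : ℝ := g.q v * (if x = v then 1 else 0) - g.B v x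

theorem uu_R (v x y : V) : g.uu v x * g.uu v y * g.R x y = g.B v x * g.B v y * g.R x y := by
  unfold uu
  have h1 := g.Rdiag v
  have h2 : ∀ z, g.B v z * g.R v z = 0 := by
    intro z
    rcases g.B01 v z with h | h
    · rw [h, zero_mul]
    · rw [g.R_of_B h, mul_zero]
  have h3 : ∀ z, g.B v z * g.R z v = 0 := by
    intro z
    rcases g.B01 v z with h | h
    · rw [h, zero_mul]
    · rw [g.R_of_B (by rw [g.Bsymm]; exact h), mul_zero]
  by_cases hx : x = v <;> by_cases hy : y = v
  · subst hx; subst hy; rw [h1]; ring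
  · subst hx; simp only [if_true, if_neg hy]
    linear_combination (-g.q x) * h2 y
  · subst hy; simp only [if_true, if_neg hx]
    linear_combination (-g.q y) * h3 x
  · simp only [if_neg hx, if_neg hy]; ring

theorem uu_B (v x y : V) : g.uu v x * g.uu v y * g.B x y =
    g.uu v x * g.uu v y - g.B v x * g.B v y * (1 - g.B x y) := by
  unfold uu
  have h1 := g.Bdiag v
  have h2 : ∀ z, g.B v z * g.B v z = g.B v z := by
    intro z
    rcases g.B01 v z with h | h <;> rw [h] <;> norm_num
  by_cases hx : x = v <;> by_cases hy : y = v
  · subst hx; subst hy; rw [h1]; ring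
  · subst hx; simp only [if_true, if_neg hy]
    linear_combination (-g.q x) * h2 y
  · subst hy; simp only [if_true, if_neg hx]; rw [g.Bsymm x y]
    linear_combination (-g.q y) * h2 x
  · simp only [if_neg hx, if_neg hy]; ring

theorem uu_sum (v : V) : ∑ x, g.uu v x = 0 := by
  unfold uu
  rw [Finset.sum_sub_distrib]
  simp [q]

theorem uu_lin (v : V) (F : V → ℝ) : ∑ x, g.uu v x * F x = g.q v * F v - ∑ x, g.B v x * F x := by
  unfold uu
  simp only [sub_mul, Finset.sum_sub_distrib]
  simp

theorem bad1_eq (v : V) : g.bad1 v = g.T (fun _ => 1) (g.uu v) (g.uu v) +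
    2 * g.T (g.uu v) (g.uu v) (fun _ => 1) + Dv g (g.mkBlue v) := by
  have e1 : g.bad1 v = ∑ x, ∑ y, ∑ z, g.uu v y * g.uu v z * (g.R x y * g.R x z) := by
    unfold bad1
    refine Finset.sum_congr rfl fun x _ => ?_
    have : g.q v * g.R x v - g.mz v x = ∑ y, g.uu v y * g.R x y := by
      rw [uu_lin]; rfl
    rw [this, sq, Finset.sum_mul_sum]
    refine Finset.sum_congr rfl fun y _ => Finset.sum_congr rfl fun z _ => by ring
  have c : g.T (g.uu v) (g.uu v) (fun _ => 1) = g.T (g.uu v) (fun _ => 1) (g.uu v) := T_comm _ _ _ _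
  rw [e1, two_mul]
  nth_rewrite 2 [c]
  unfold T Dv
  simp only [← Finset.sum_add_distrib]
  refine Finset.sum_congr rfl fun x _ => Finset.sum_congr rfl fun y _ =>
    Finset.sum_congr rfl fun z _ => ?_
  simp only [mkBlue]
  linear_combination (-g.R x y * g.R x z) * g.uu_B v y z - g.R x z * g.B y z * g.uu_R v x y
    - g.R x y * g.B y z * g.uu_R v x z

theorem uu_abs (v : V) : ∑ x, |g.uu v x| ≤ 2 * (Fintype.card V : ℝ) := by
  have : ∑ x, |g.uu v x| ≤ ∑ x, (g.q v * (if x = v then 1 else 0) + g.B v x) := by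
    refine Finset.sum_le_sum fun x _ => ?_
    unfold uu
    have a := g.q_nonneg v
    have b := g.B_nonneg v x
    rw [abs_le]
    split_ifs <;> constructor <;> linarith
  refine this.trans ?_
  rw [Finset.sum_add_distrib]
  have h := g.q_le v
  simp
  unfold q at h ⊢
  linarith

theorem T_uuu (v : V) : - (8 * (Fintype.card V : ℝ) ^ 3) ≤ g.T (g.uu v) (g.uu v) (g.uu v) := by
  have : -g.T (g.uu v) (g.uu v) (g.uu v) ≤ (∑ x, |g.uu v x|) ^ 3 := by
    have : (∑ x, |g.uu v x|) ^ 3 = ∑ x, ∑ y, ∑ z, |g.uu v x| * |g.uu v y| * |g.uu v z| := by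
      rw [pow_succ, sq, Finset.sum_mul_sum, Finset.sum_mul]
      refine Finset.sum_congr rfl fun x _ => ?_
      rw [Finset.sum_mul_sum]
    rw [this]; unfold T
    simp only [← Finset.sum_neg_distrib]
    refine Finset.sum_le_sum fun x _ => Finset.sum_le_sum fun y _ => Finset.sum_le_sum fun z _ => ?_
    rw [← abs_mul, ← abs_mul]
    have ha := neg_le_abs (g.uu v x * g.uu v y * g.uu v z)
    have hb := abs_nonneg (g.uu v x * g.uu v y * g.uu v z)
    rcases g.R01 x y with h1 | h1 <;> rcases g.R01 x z with h2 | h2 <;>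
    rcases g.B01 y z with h3 | h3 <;> rw [h1, h2, h3] <;> linarith
  have h2 : (∑ x, |g.uu v x|) ^ 3 ≤ (2 * (Fintype.card V : ℝ)) ^ 3 := by
    have := g.uu_abs v
    have h0 : 0 ≤ ∑ x, |g.uu v x| := Finset.sum_nonneg fun x _ => abs_nonneg _
    gcongr
  have h3 : (2 * (Fintype.card V : ℝ)) ^ 3 = 8 * (Fintype.card V : ℝ) ^ 3 := by ring
  linarith

end

open Classical in
theorem L4 (η : ℝ) (hη : 0 < η) : ∃ ε : ℝ, 0 < ε ∧ ∀ (V : Type) [Fintype V] [DecidableEq V]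
    (g : CG V), g.Near ε → ∀ v, (3 * tau - ε) * (Fintype.card V : ℝ) ^ 2 ≤ g.deg v →
      g.bad1 v ≤ η * (Fintype.card V : ℝ) ^ 3 := by
  obtain ⟨k, hk⟩ := exists_nat_gt (max 1 (32 / η))
  have k1 : (1 : ℝ) < k := (le_max_left _ _).trans_lt hk
  have k2 : 32 / η < k := (le_max_right _ _).trans_lt hk
  rw [div_lt_iff₀ hη] at k2
  have hk0 : (0 : ℝ) < k := by linarith
  obtain ⟨ε₁, hε₁, H1⟩ := deg_upper (η / (8 * k)) (by positivity)
  obtain ⟨ε₂, hε₂, H2⟩ := edge_opt (η / 4) (by positivity)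
  refine ⟨min (η / (16 * k ^ 2)) (min ε₁ ε₂), by positivity, fun V _ _ g hg v hv => ?_⟩
  set ε := min (η / (16 * k ^ 2)) (min ε₁ ε₂) with hε
  have hεk : ε ≤ η / (16 * k ^ 2) := min_le_left _ _
  have hεk' : ε * k ^ 2 ≤ η / 16 := by
    calc ε * k ^ 2 ≤ η / (16 * k ^ 2) * k ^ 2 := by gcongr
      _ = η / 16 := by field_simp
  have hε0 : 0 < ε := by rw [hε]; positivity
  have D := H1 V g (hg.mono ((min_le_right _ _).trans (min_le_left _ _)))
  have E := H2 V g (hg.mono ((min_le_right _ _).trans (min_le_right _ _))) (g.mkBlue v)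
  obtain ⟨h1, h2⟩ := hg
  set n : ℝ := (Fintype.card V : ℝ) with hn
  have hn0 : 0 < n := by
    by_contra hc
    push Not at hc
    nlinarith
  set Q := (Finset.univ.filter fun x => g.B v x = 1).card with hQ
  have hQ' : (Q : ℝ) = g.q v := g.q_nat v
  have hkk : 1 ≤ k := by exact_mod_cast k1.le
  have p := g.perturb k (g.uu v) (fun x => k + (if x = v then Q else 0) -
    (if g.B v x = 1 then 1 else 0)) (by
      intro x
      rw [Nat.cast_sub (by split_ifs <;> omega)]
      unfold uu
      rw [← hQ']
      rcases g.B01 v x with h | h <;> simp [h] <;> ring)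
  rw [uu_sum] at p
  have d : -((ε + η / (8 * k)) * n ^ 3) ≤ ∑ x, g.uu v x * g.deg x := by
    rw [uu_lin]
    have a1 : g.q v * ((3 * tau - ε) * n ^ 2) ≤ g.q v * g.deg v :=
      mul_le_mul_of_nonneg_left hv (g.q_nonneg v)
    have a2 : ∑ x, g.B v x * g.deg x ≤ g.q v * ((3 * tau + η / (8 * k)) * n ^ 2) := by
      unfold q
      rw [Finset.sum_mul]
      refine Finset.sum_le_sum fun x _ => mul_le_mul_of_nonneg_left (D x) (g.B_nonneg v x)
    have a3 : g.q v * ((ε + η / (8 * k)) * n ^ 2) ≤ n * ((ε + η / (8 * k)) * n ^ 2) :=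
      mul_le_mul_of_nonneg_right (g.q_le v) (by positivity)
    linarith
  have t := g.T_uuu v
  have be := g.bad1_eq v
  set bad := g.T (fun _ => 1) (g.uu v) (g.uu v) + 2 * g.T (g.uu v) (g.uu v) (fun _ => 1) with hbad
  have c1 : k * bad ≤ 8 * n ^ 3 + k ^ 2 * (2 * ε + η / (8 * k)) * n ^ 3 + k ^ 3 * ε * n ^ 3 := by
    have d' := mul_le_mul_of_nonneg_left d (by positivity : (0 : ℝ) ≤ (k : ℝ) ^ 2)
    have c2 := mul_le_mul_of_nonneg_left h1 (by positivity : (0 : ℝ) ≤ (k : ℝ) ^ 3)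
    have c3 : (k * n) ^ 2 * 1 ≤ (k * n) ^ 2 * (ε * n) := by gcongr
    rw [zero_add] at p
    nlinarith
  have c2 : 8 * n ^ 3 + k ^ 2 * (2 * ε + η / (8 * k)) * n ^ 3 + k ^ 3 * ε * n ^ 3
      ≤ k * (3 / 4 * η * n ^ 3) := by
    have e1 : k ^ 2 * (2 * ε + η / (8 * k)) = 2 * (ε * k ^ 2) + k * η / 8 := by field_simp
    rw [e1]
    have e2 : k ^ 3 * ε ≤ k * (η / 16) := by
      calc k ^ 3 * ε = k * (ε * k ^ 2) := by ring
        _ ≤ _ := by gcongr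
    have e3 : η ≤ k * η := by nlinarith
    have : 8 + (2 * (ε * k ^ 2) + k * η / 8) + k ^ 3 * ε ≤ k * (3 / 4 * η) := by linarith
    have := mul_le_mul_of_nonneg_right this (by positivity : 0 ≤ n ^ 3)
    linarith
  have c3 : bad ≤ 3 / 4 * η * n ^ 3 := le_of_mul_le_mul_left (c1.trans c2) hk0
  linarith

end CG


namespace CG

theorem typ_deg (ε' θ : ℝ) (hε' : 0 < ε') (hθ : 0 < θ) :
    ∃ ε : ℝ, 0 < ε ∧ ∀ (V : Type) [Fintype V] [DecidableEq V]
    (g : CG V), g.Near ε → ∃ W : Finset V, ((Wᶜ).card : ℝ) ≤ θ * (Fintype.card V : ℝ) ∧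
      ∀ v ∈ W, (3 * tau - ε') * (Fintype.card V : ℝ) ^ 2 ≤ g.deg v := by
  classical
  obtain ⟨ε₁, hε₁, H⟩ := deg_upper (θ * ε' / 2) (by positivity)
  refine ⟨min ε₁ (θ * ε' / 6), by positivity, fun V _ _ g hg => ?_⟩
  have D := H V g (hg.mono (min_le_left _ _))
  obtain ⟨h1, h2⟩ := hg.mono (min_le_right _ _)
  set n : ℝ := (Fintype.card V : ℝ) with hn
  refine ⟨Finset.univ.filter fun v => (3 * tau - ε') * n ^ 2 ≤ g.deg v, ?_, by simp⟩
  have hn0 : 0 < n := by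
    by_contra hc
    push Not at hc
    have : 0 < θ * ε' := by positivity
    nlinarith
  set W := Finset.univ.filter fun v => (3 * tau - ε') * n ^ 2 ≤ g.deg v with hW
  have s : ∑ x, ((3 * tau + θ * ε' / 2) * n ^ 2 - g.deg x) ≤ (θ * ε') * n ^ 3 := by
    rw [Finset.sum_sub_distrib, sum_deg]
    simp only [Finset.sum_const, Finset.card_univ, nsmul_eq_mul, ← hn]
    nlinarith
  have s2 : ∑ x ∈ Wᶜ, (ε' * n ^ 2) ≤ ∑ x, ((3 * tau + θ * ε' / 2) * n ^ 2 - g.deg x) := by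
    calc ∑ x ∈ Wᶜ, (ε' * n ^ 2) ≤ ∑ x ∈ Wᶜ, ((3 * tau + θ * ε' / 2) * n ^ 2 - g.deg x) := by
          refine Finset.sum_le_sum fun x hx => ?_
          simp only [hW, Finset.mem_compl, Finset.mem_filter, Finset.mem_univ, true_and, not_le] at hx
          have : 0 ≤ θ * ε' / 2 * n ^ 2 := by positivity
          linarith
      _ ≤ _ := by
          refine Finset.sum_le_sum_of_subset_of_nonneg (Finset.subset_univ _) fun x _ _ => ?_
          linarith [D x]
  rw [Finset.sum_const, nsmul_eq_mul] at s2
  have s3 : ((Wᶜ.card : ℕ) : ℝ) * (ε' * n ^ 2) ≤ (θ * n) * (ε' * n ^ 2) := by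
    refine (s2.trans s).trans (le_of_eq ?_); ring
  exact le_of_mul_le_mul_right s3 (by positivity)

section
variable {V : Type} [Fintype V] [DecidableEq V] (g : CG V)

noncomputable def L1 (v : V) : ℝ := ∑ z, |g.q v * g.R z v - g.mz v z|

noncomputable def bad2 (v : V) : ℝ := ∑ x, ∑ z, g.B v x * (g.B x z * g.R v z)

theorem L1_sq (v : V) : g.L1 v ^ 2 ≤ (Fintype.card V : ℝ) * g.bad1 v := by
  unfold L1 bad1
  have := sq_sum_le_card_mul_sum_sq (s := (Finset.univ : Finset V))
    (f := fun z => |g.q v * g.R z v - g.mz v z|)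
  simpa using this

theorem sum_bad2 : ∑ v, g.bad2 v = ∑ x, ∑ z, g.B x z * g.mz x z := by
  unfold bad2 mz
  rw [Finset.sum_comm]
  refine Finset.sum_congr rfl fun x _ => Finset.sum_congr rfl fun v _ => ?_
  rw [Finset.mul_sum]
  refine Finset.sum_congr rfl fun z _ => ?_
  rw [g.Bsymm v x]

theorem rho_le (x : V) : ∑ z, g.B x z * g.mz x z ≤ g.L1 x := by
  unfold L1
  refine Finset.sum_le_sum fun z _ => ?_
  rcases g.B01 x z with h | h
  · rw [h, zero_mul]; exact abs_nonneg _
  · rw [h, g.R_of_B (x := z) (y := x) (by rw [g.Bsymm]; exact h), one_mul, mul_zero, zero_sub, abs_neg]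
    exact le_abs_self _

theorem rho_le' (x : V) : ∑ z, g.B x z * g.mz x z ≤ (Fintype.card V : ℝ) ^ 2 := by
  unfold mz
  have : ∀ z, g.B x z * ∑ y, g.B x y * g.R z y ≤ (Fintype.card V : ℝ) := by
    intro z
    rw [Finset.mul_sum]
    calc ∑ y, g.B x z * (g.B x y * g.R z y) ≤ ∑ _y : V, (1 : ℝ) := by
          refine Finset.sum_le_sum fun y _ => ?_
          rcases g.B01 x z with h | h <;> rcases g.B01 x y with h1 | h1 <;>
          rcases g.R01 z y with h2 | h2 <;> rw [h, h1, h2] <;> norm_num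
      _ = _ := by simp
  calc _ ≤ ∑ _z : V, (Fintype.card V : ℝ) := Finset.sum_le_sum fun z _ => this z
    _ = _ := by simp [sq]

theorem bad2_nonneg (v : V) : 0 ≤ g.bad2 v :=
  Finset.sum_nonneg fun x _ => Finset.sum_nonneg fun z _ =>
    mul_nonneg (g.B_nonneg _ _) (mul_nonneg (g.B_nonneg _ _) (g.R_nonneg _ _))

end

theorem typ (η : ℝ) (hη : 0 < η) : ∃ ε : ℝ, 0 < ε ∧ ∀ (V : Type) [Fintype V] [DecidableEq V]
    (g : CG V), g.Near ε → ∃ W : Finset V, ((Wᶜ).card : ℝ) ≤ η * (Fintype.card V : ℝ) ∧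
      ∀ v ∈ W, g.L1 v ≤ η * (Fintype.card V : ℝ) ^ 2 ∧ g.bad2 v ≤ η * (Fintype.card V : ℝ) ^ 2 := by
  classical
  set θ := min (η / 2) (η ^ 2 / 4) with hθ
  have hθ0 : 0 < θ := by positivity
  obtain ⟨ε₁, hε₁, H1⟩ := L4 (θ ^ 2) (by positivity)
  obtain ⟨ε₂, hε₂, H2⟩ := typ_deg ε₁ θ hε₁ hθ0
  refine ⟨min ε₁ ε₂, by positivity, fun V _ _ g hg => ?_⟩
  obtain ⟨W, hW, hd⟩ := H2 V g (hg.mono (min_le_right _ _))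
  have hb := H1 V g (hg.mono (min_le_left _ _))
  have h2 := hg.2
  set n : ℝ := (Fintype.card V : ℝ) with hn
  have hn0 : 0 < n := by
    by_contra hc
    push Not at hc
    have : 0 < min ε₁ ε₂ := by positivity
    nlinarith
  have hL : ∀ v ∈ W, g.L1 v ≤ θ * n ^ 2 := by
    intro v hv
    have a := g.L1_sq v
    have b := hb v (hd v hv)
    refine abs_le_of_sq_le_sq' ?_ (by positivity) |>.2
    calc g.L1 v ^ 2 ≤ n * g.bad1 v := a
      _ ≤ n * (θ ^ 2 * n ^ 3) := by gcongr
      _ = _ := by ring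
  have hs : ∑ v, g.bad2 v ≤ 2 * θ * n ^ 3 := by
    rw [sum_bad2, ← Finset.sum_add_sum_compl W]
    have a : ∑ x ∈ W, ∑ z, g.B x z * g.mz x z ≤ θ * n ^ 3 := by
      calc _ ≤ ∑ x ∈ W, θ * n ^ 2 := Finset.sum_le_sum fun x hx => (g.rho_le x).trans (hL x hx)
        _ = W.card * (θ * n ^ 2) := by rw [Finset.sum_const, nsmul_eq_mul]
        _ ≤ n * (θ * n ^ 2) := by
          gcongr
          rw [hn]; exact_mod_cast W.card_le_univ
        _ = _ := by ring
    have b : ∑ x ∈ Wᶜ, ∑ z, g.B x z * g.mz x z ≤ θ * n ^ 3 := by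
      calc _ ≤ ∑ x ∈ Wᶜ, n ^ 2 := Finset.sum_le_sum fun x hx => (g.rho_le' x)
        _ = Wᶜ.card * n ^ 2 := by rw [Finset.sum_const, nsmul_eq_mul]
        _ ≤ (θ * n) * n ^ 2 := by gcongr
        _ = _ := by ring
    linarith
  set U := Finset.univ.filter fun v => g.bad2 v ≤ η * n ^ 2 with hU
  have hUc : (Uᶜ.card : ℝ) ≤ η / 2 * n := by
    have s2 : ∑ x ∈ Uᶜ, (η * n ^ 2) ≤ 2 * θ * n ^ 3 := by
      calc ∑ x ∈ Uᶜ, (η * n ^ 2) ≤ ∑ x ∈ Uᶜ, g.bad2 x := by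
            refine Finset.sum_le_sum fun x hx => ?_
            simp only [hU, Finset.mem_compl, Finset.mem_filter, Finset.mem_univ, true_and,
              not_le] at hx
            exact hx.le
        _ ≤ _ := (Finset.sum_le_sum_of_subset_of_nonneg (Finset.subset_univ _)
              fun x _ _ => g.bad2_nonneg x)
        _ ≤ _ := hs
    rw [Finset.sum_const, nsmul_eq_mul] at s2
    have : θ ≤ η ^ 2 / 4 := min_le_right _ _
    have s3 : ((Uᶜ.card : ℕ) : ℝ) * (η * n ^ 2) ≤ (η / 2 * n) * (η * n ^ 2) := by
      refine s2.trans ?_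
      calc 2 * θ * n ^ 3 ≤ 2 * (η ^ 2 / 4) * n ^ 3 := by gcongr
        _ = _ := by ring
    exact le_of_mul_le_mul_right s3 (by positivity)
  have hθη : θ ≤ η / 2 := min_le_left _ _
  refine ⟨W ∩ U, ?_, fun v hv => ?_⟩
  · rw [Finset.compl_inter]
    have : ((Wᶜ ∪ Uᶜ).card : ℝ) ≤ Wᶜ.card + Uᶜ.card := by exact_mod_cast Finset.card_union_le _ _
    have : θ * n ≤ η / 2 * n := by gcongr
    linarith
  · rw [Finset.mem_inter] at hv
    refine ⟨(hL v hv.1).trans ?_, ?_⟩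
    · gcongr; linarith
    · simpa [hU] using hv.2

end CG


namespace CG

/-- pull-back of a coloured graph -/
def comap {V U : Type} (φ : U → V) (g : CG V) : CG U where
  R x y := g.R (φ x) (φ y)
  B x y := g.B (φ x) (φ y)
  R01 _ _ := g.R01 _ _
  B01 _ _ := g.B01 _ _
  Bsymm _ _ := g.Bsymm _ _
  Bdiag _ := g.Bdiag _
  tri _ _ := g.tri _ _

section
variable {V : Type} [Fintype V]

/-- edit distance -/
noncomputable def E (g g' : CG V) : ℝ := ∑ x, ∑ y, |g.R x y - g'.R x y|

theorem E_tri (g g' g'' : CG V) : E g g'' ≤ E g g' + E g' g'' := by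
  unfold E
  simp only [← Finset.sum_add_distrib]
  exact Finset.sum_le_sum fun x _ => Finset.sum_le_sum fun y _ => abs_sub_le _ _ _

theorem T_diff (g g' : CG V) : g.T (fun _ => 1) (fun _ => 1) (fun _ => 1) ≤
    g'.T (fun _ => 1) (fun _ => 1) (fun _ => 1) + 4 * (Fintype.card V : ℝ) * E g g' := by
  have e1 : ∑ x, ∑ y, ∑ _z : V, |g.R x y - g'.R x y| = (Fintype.card V : ℝ) * E g g' := by
    unfold E; simp [Finset.mul_sum]
  have e2 : ∑ x, ∑ _y : V, ∑ z, |g.R x z - g'.R x z| = (Fintype.card V : ℝ) * E g g' := by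
    unfold E; simp [Finset.mul_sum]
  have e3 : ∑ _x : V, ∑ y, ∑ z, |g.R y z - g'.R y z| = (Fintype.card V : ℝ) * E g g' := by
    unfold E; simp
  have e4 : ∑ _x : V, ∑ y, ∑ z, |g.R z y - g'.R z y| = (Fintype.card V : ℝ) * E g g' := by
    unfold E; rw [Finset.sum_const, Finset.sum_comm]; simp
  have : 4 * (Fintype.card V : ℝ) * E g g' = ∑ x, ∑ y, ∑ z, (|g.R x y - g'.R x y| +
      |g.R x z - g'.R x z| + |g.R y z - g'.R y z| + |g.R z y - g'.R z y|) := by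
    simp only [Finset.sum_add_distrib, e1, e2, e3, e4]; ring
  rw [this]; unfold T
  simp only [← Finset.sum_add_distrib]
  refine Finset.sum_le_sum fun x _ => Finset.sum_le_sum fun y _ => Finset.sum_le_sum fun z _ => ?_
  have t1 := g.tri y z
  have t2 := g'.tri y z
  have a1 : |g.B y z - g'.B y z| ≤ |g.R y z - g'.R y z| + |g.R z y - g'.R z y| := by
    have : g.B y z - g'.B y z = -((g.R y z - g'.R y z) + (g.R z y - g'.R z y)) := by linarith
    rw [this, abs_neg]; exact abs_add_le _ _
  have a2 : g.R x y * g.R x z * g.B y z - g'.R x y * g'.R x z * g'.B y z ≤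
      |g.R x y - g'.R x y| + |g.R x z - g'.R x z| + |g.B y z - g'.B y z| := by
    rcases g.R01 x y with h1 | h1 <;> rcases g.R01 x z with h2 | h2 <;>
    rcases g.B01 y z with h3 | h3 <;> rcases g'.R01 x y with h4 | h4 <;>
    rcases g'.R01 x z with h5 | h5 <;> rcases g'.B01 y z with h6 | h6 <;>
    rw [h1, h2, h3, h4, h5, h6] <;> norm_num
  linarith

end

section
variable {V : Type} [Fintype V] [DecidableEq V] (g : CG V)

open Classical in
/-- replace the blue neighbourhood of `v` by clones of `v` -/
noncomputable def clone (v : V) : CG V := g.comap fun x => if g.B v x = 1 then v else x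

theorem clone_T (v : V) : (g.clone v).T (fun _ => 1) (fun _ => 1) (fun _ => 1) =
    g.T (fun x => 1 - g.B v x) (fun x => 1 - g.B v x) (fun x => 1 - g.B v x) +
    g.q v ^ 2 * (∑ x, g.R x v) + g.q v * ∑ y, ∑ z, g.R v y * (g.R v z * g.B y z) := by
  have e1 : g.q v ^ 2 * (∑ x, g.R x v) = ∑ x, ∑ y, ∑ z, g.R x v * g.B v y * g.B v z := by
    unfold q
    rw [sq, Finset.sum_mul_sum, mul_comm, Finset.sum_mul]
    simp only [Finset.mul_sum, mul_assoc]
  have e2 : g.q v * ∑ y, ∑ z, g.R v y * (g.R v z * g.B y z) =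
      ∑ x, ∑ y, ∑ z, g.B v x * (g.R v y * (g.R v z * g.B y z)) := by
    unfold q
    rw [Finset.sum_mul]
    simp only [Finset.mul_sum]
  rw [e1, e2]; unfold T
  simp only [← Finset.sum_add_distrib]
  refine Finset.sum_congr rfl fun x _ => Finset.sum_congr rfl fun y _ =>
    Finset.sum_congr rfl fun z _ => ?_
  have r1 : ∀ t, g.B v t = 1 → g.R v t = 0 := fun t h => g.R_of_B h
  have r2 : ∀ t, g.B v t = 1 → g.R t v = 0 := fun t h => g.R_of_B (by rw [g.Bsymm]; exact h)
  have r3 := g.Rdiag v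
  have r4 := g.Bdiag v
  have r5 := g.R_sq x v
  simp only [clone, comap]
  rcases g.B01 v x with hx | hx <;> rcases g.B01 v y with hy | hy <;>
  rcases g.B01 v z with hz | hz <;>
  simp [hx, hy, hz, r3, r4, r5, r1, r2, g.Bsymm y v]
  ring

theorem clone_E (v : V) : E g (g.clone v) ≤ 2 * g.L1 v + g.bad2 v := by
  have e1 : g.L1 v = ∑ x, ∑ y, g.B v y * |g.R x y - g.R x v| := by
    unfold L1
    refine Finset.sum_congr rfl fun x _ => ?_
    rcases g.R01 x v with h | h
    · rw [h, mul_zero, zero_sub, abs_neg]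
      have : ∀ y, |g.R x y - 0| = g.R x y := fun y => by rw [sub_zero, abs_of_nonneg (g.R_nonneg _ _)]
      simp only [this]
      rw [abs_of_nonneg]; · rfl
      exact Finset.sum_nonneg fun y _ => mul_nonneg (g.B_nonneg _ _) (g.R_nonneg _ _)
    · rw [h, mul_one]
      have : ∀ y, g.B v y * |g.R x y - 1| = g.B v y - g.B v y * g.R x y := fun y => by
        rw [abs_of_nonpos (by linarith [g.R_le x y])]; ring
      simp only [this, Finset.sum_sub_distrib]
      rw [abs_of_nonneg]; · rfl
      rw [sub_nonneg]
      unfold mz q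
      refine Finset.sum_le_sum fun y _ => ?_
      have := g.R_le x y
      have := g.B_nonneg v y
      nlinarith
  have e2 : g.L1 v = ∑ x, ∑ y, g.B v x * |g.R y x - g.R y v| := by
    rw [e1, Finset.sum_comm]
  have e3 : 2 * g.L1 v + g.bad2 v = ∑ x, ∑ y, (g.B v y * |g.R x y - g.R x v| +
      g.B v x * |g.R y x - g.R y v| + g.B v x * (g.B x y * g.R v y)) := by
    simp only [Finset.sum_add_distrib, ← e1, ← e2]; unfold bad2; ring
  rw [e3]; unfold E
  refine Finset.sum_le_sum fun x _ => Finset.sum_le_sum fun y _ => ?_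
  have r1 : ∀ t, g.B v t = 1 → g.R v t = 0 := fun t h => g.R_of_B h
  have r2 : ∀ t, g.B v t = 1 → g.R t v = 0 := fun t h => g.R_of_B (by rw [g.Bsymm]; exact h)
  have r3 := g.Rdiag v
  have tx := g.tri x y
  have tv := g.tri v y
  simp only [clone, comap]
  rcases g.B01 v x with hx | hx <;> rcases g.B01 v y with hy | hy <;>
  simp [hx, hy, r3, r1, r2]
  rw [hy] at tv
  rcases g.R01 x y with h1 | h1 <;> rcases g.R01 y x with h2 | h2 <;>
  rcases g.R01 v y with h3 | h3 <;> rcases g.R01 y v with h4 | h4 <;>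
  rcases g.B01 x y with h5 | h5 <;>
  rw [h1, h2, h5] at tx <;> rw [h3, h4] at tv <;> rw [h1, h2, h3, h4, h5] <;>
  first | (exfalso; linarith) | norm_num

/-- make `A` blue, all the rest pointing into `A` -/
noncomputable def split (A : Finset V) : CG V where
  R x y := if x ∈ A then 0 else if y ∈ A then 1 else g.R x y
  B x y := if x ∈ A then (if y ∈ A then 1 else 0) else if y ∈ A then 0 else g.B x y
  R01 x y := by split_ifs <;> simp [g.R01]
  B01 x y := by split_ifs <;> simp [g.B01]
  Bsymm x y := by split_ifs <;> simp [g.Bsymm x y]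
  Bdiag x := by split_ifs <;> simp [g.Bdiag]
  tri x y := by split_ifs <;> simp [g.tri]

theorem split_T (A : Finset V) : (g.split A).T (fun _ => 1) (fun _ => 1) (fun _ => 1) =
    g.T (fun x => if x ∈ A then 0 else 1) (fun x => if x ∈ A then 0 else 1)
      (fun x => if x ∈ A then 0 else 1) +
    (A.card : ℝ) ^ 2 * ((Fintype.card V : ℝ) - A.card) := by
  have e0 : (A.card : ℝ) = ∑ y, if y ∈ A then (1 : ℝ) else 0 := by simp
  have e00 : (Fintype.card V : ℝ) - A.card = ∑ y, if y ∈ A then (0 : ℝ) else 1 := by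
    have : ∀ y, (if y ∈ A then (0 : ℝ) else 1) = 1 - if y ∈ A then (1 : ℝ) else 0 := by
      intro y; split_ifs <;> norm_num
    simp only [this, Finset.sum_sub_distrib, ← e0]; simp
  have e1 : (A.card : ℝ) ^ 2 * ((Fintype.card V : ℝ) - A.card) = ∑ x, ∑ y, ∑ z,
      (if x ∈ A then (0 : ℝ) else 1) * ((if y ∈ A then (1 : ℝ) else 0) *
        (if z ∈ A then (1 : ℝ) else 0)) := by
    rw [e00, e0, sq, Finset.sum_mul_sum, mul_comm, Finset.sum_mul]
    simp only [Finset.mul_sum]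
  rw [e1]; unfold T
  simp only [← Finset.sum_add_distrib]
  refine Finset.sum_congr rfl fun x _ => Finset.sum_congr rfl fun y _ =>
    Finset.sum_congr rfl fun z _ => ?_
  simp only [split]
  by_cases hx : x ∈ A <;> by_cases hy : y ∈ A <;> by_cases hz : z ∈ A <;> simp [hx, hy, hz]

theorem clone_split_E (v : V) (A : Finset V) (hA : ∀ x, x ∈ A ↔ g.B v x = 1) :
    E (g.clone v) (g.split A) ≤ 2 * (Fintype.card V : ℝ) * ∑ y, g.R v y := by
  have e1 : ∑ _x : V, ∑ y, g.R v y = (Fintype.card V : ℝ) * ∑ y, g.R v y := by simp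
  have e2 : ∑ x : V, ∑ _y : V, g.R v x = (Fintype.card V : ℝ) * ∑ y, g.R v y := by
    rw [Finset.sum_comm]; simp
  have : 2 * (Fintype.card V : ℝ) * ∑ y, g.R v y = ∑ x, ∑ y, (g.R v y + g.R v x) := by
    simp only [Finset.sum_add_distrib, e1, e2]; ring
  rw [this]; unfold E
  refine Finset.sum_le_sum fun x _ => Finset.sum_le_sum fun y _ => ?_
  have a := g.R_nonneg v x
  have b := g.R_nonneg v y
  have tx := g.tri v x
  simp only [clone, comap, split, hA]
  rcases g.B01 v x with hx | hx <;> rcases g.B01 v y with hy | hy <;> simp [hx, hy]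
  · positivity
  · rw [hx] at tx; rw [abs_of_nonpos (by linarith [g.R_le x v])]; linarith
  · rw [abs_of_nonneg b]; linarith
  · rw [g.Rdiag]; simp; positivity

theorem rest_le (A : Finset V) : g.T (fun x => if x ∈ A then 0 else 1)
    (fun x => if x ∈ A then 0 else 1) (fun x => if x ∈ A then 0 else 1) ≤
    tau * ((Fintype.card V : ℝ) - A.card) ^ 3 + ((Fintype.card V : ℝ) - A.card) ^ 2 := by
  have e0 : (A.card : ℝ) = ∑ y, if y ∈ A then (1 : ℝ) else 0 := by simp
  have e00 : (Fintype.card V : ℝ) - A.card = ∑ y, if y ∈ A then (0 : ℝ) else 1 := by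
    have : ∀ y, (if y ∈ A then (0 : ℝ) else 1) = 1 - if y ∈ A then (1 : ℝ) else 0 := by
      intro y; split_ifs <;> norm_num
    simp only [this, Finset.sum_sub_distrib, ← e0]; simp
  have := g.upper (fun x => if x ∈ A then 0 else 1)
  rw [e00]
  simpa using this

end

end CG


namespace CG

section
variable {V : Type} [Fintype V] [DecidableEq V] (g : CG V)

theorem q_in_out (v : V) : g.q v + (∑ x, g.R x v) + ∑ y, g.R v y = Fintype.card V := by
  have : ∑ x, (g.B v x + g.R v x + g.R x v) = ∑ _x : V, (1 : ℝ) :=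
    Finset.sum_congr rfl fun x _ => g.tri v x
  simp only [Finset.sum_add_distrib] at this
  simp at this
  unfold q
  linarith

theorem T_le_q : g.T (fun _ => 1) (fun _ => 1) (fun _ => 1) ≤ (Fintype.card V : ℝ) * ∑ y, g.q y := by
  have : (Fintype.card V : ℝ) * ∑ y, g.q y = ∑ _x : V, ∑ y, ∑ z, g.B y z := by
    unfold q; simp
  rw [this]; unfold T
  refine Finset.sum_le_sum fun x _ => Finset.sum_le_sum fun y _ => Finset.sum_le_sum fun z _ => ?_
  rcases g.R01 x y with h1 | h1 <;> rcases g.R01 x z with h2 | h2 <;>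
  rcases g.B01 y z with h3 | h3 <;> rw [h1, h2, h3] <;> norm_num

end

set_option maxHeartbeats 2000000 in
theorem lemS (δ : ℝ) (hδ : 0 < δ) : ∃ ε : ℝ, 0 < ε ∧ ∀ (V : Type) [Fintype V] [DecidableEq V]
    (g : CG V), g.Near ε → ∃ A : Finset V, |(A.card : ℝ) - bet * (Fintype.card V : ℝ)| ≤
      δ * (Fintype.card V : ℝ) ∧ E g (g.split A) ≤ δ * (Fintype.card V : ℝ) ^ 2 := by
  classical
  set d := min δ 0.03 with hd
  have d0 : 0 < d := by positivity
  have d1 : d ≤ δ := min_le_left _ _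
  have d2 : d ≤ 0.03 := min_le_right _ _
  set κ := d ^ 2 / 30 with hκ
  have κ0 : 0 < κ := by positivity
  set η := κ / 26 with hη
  have η0 : 0 < η := by positivity
  obtain ⟨ε₁, hε₁, H⟩ := typ η η0
  refine ⟨min (κ / 4) ε₁, by positivity, fun V _ _ g hg => ?_⟩
  obtain ⟨W, hW, hw⟩ := H V g (hg.mono (min_le_right _ _))
  obtain ⟨h1, h2⟩ := hg.mono (min_le_left _ _)
  set n : ℝ := (Fintype.card V : ℝ) with hn
  have hn0 : 0 < n := by
    by_contra hc
    push Not at hc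
    nlinarith
  have κs : κ ≤ 0.0001 := by rw [hκ]; nlinarith
  have hWne : W.Nonempty := by
    by_contra hc
    rw [Finset.not_nonempty_iff_eq_empty] at hc
    rw [hc, Finset.compl_empty, Finset.card_univ, ← hn] at hW
    nlinarith
  obtain ⟨v, hv, hmax⟩ := Finset.exists_max_image W g.q hWne
  obtain ⟨w1, w2⟩ := hw v hv
  set I := ∑ x, g.R x v with hI
  set O := ∑ y, g.R v y with hO
  have h_inout := g.q_in_out v
  rw [← hI, ← hO, ← hn] at h_inout
  have I0 : 0 ≤ I := Finset.sum_nonneg fun x _ => g.R_nonneg _ _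
  have O0 : 0 ≤ O := Finset.sum_nonneg fun x _ => g.R_nonneg _ _
  set A := Finset.univ.filter fun x => g.B v x = 1 with hA
  have hAq : (A.card : ℝ) = g.q v := g.q_nat v
  have hAm : ∀ x, x ∈ A ↔ g.B v x = 1 := by simp [hA]
  have q0 := g.q_nonneg v
  have hind : (fun x => 1 - g.B v x) = fun x => if x ∈ A then 0 else 1 := by
    funext x
    simp only [hAm]
    rcases g.B01 v x with h | h <;> simp [h]
  have T1 := g.clone_T v
  rw [hind, ← hI] at T1
  have Tr := g.rest_le A
  have E1 := g.clone_E v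
  have E1' : E g (g.clone v) ≤ 3 * η * n ^ 2 := by linarith
  have E2 := g.clone_split_E v A hAm
  rw [← hO, ← hn] at E2
  have Td := T_diff g (g.clone v)
  have Tq := g.T_le_q
  rw [hAq] at Tr
  rw [← hn] at Tr Td Tq
  have hWc : ∑ y, g.q y ≤ n * g.q v + η * n ^ 2 := by
    rw [← Finset.sum_add_sum_compl W]
    have a : ∑ x ∈ W, g.q x ≤ n * g.q v := by
      calc _ ≤ ∑ x ∈ W, g.q v := Finset.sum_le_sum fun x hx => hmax x hx
        _ = W.card * g.q v := by rw [Finset.sum_const, nsmul_eq_mul]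
        _ ≤ n * g.q v := by
          gcongr
          rw [hn]; exact_mod_cast W.card_le_univ
    have b : ∑ x ∈ Wᶜ, g.q x ≤ η * n ^ 2 := by
      calc _ ≤ ∑ x ∈ Wᶜ, n := Finset.sum_le_sum fun x hx => g.q_le x
        _ = Wᶜ.card * n := by rw [Finset.sum_const, nsmul_eq_mul]
        _ ≤ (η * n) * n := by gcongr
        _ = _ := by ring
    linarith
  set OO := ∑ y, ∑ z, g.R v y * (g.R v z * g.B y z) with hOO
  have O1 : OO ≤ O ^ 2 := by
    rw [hOO, sq, hO, Finset.sum_mul_sum]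
    refine Finset.sum_le_sum fun y _ => Finset.sum_le_sum fun z _ => ?_
    have a := g.R_nonneg v y
    have b := g.R_nonneg v z
    have c := g.B_le y z
    have := mul_nonneg a b
    nlinarith
  have O2 : OO ≤ g.q v * O + η * n ^ 2 := by
    have a : OO ≤ ∑ y, g.R v y * g.q y := by
      rw [hOO]; unfold q
      simp only [Finset.mul_sum]
      refine Finset.sum_le_sum fun y _ => Finset.sum_le_sum fun z _ => ?_
      have a := g.R_nonneg v y
      have b := g.R_le v z
      have c := g.B_nonneg y z
      have := mul_nonneg a c
      nlinarith
    have b : ∀ y, g.R v y * g.q y ≤ g.R v y * g.q v + if y ∈ W then 0 else n := by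
      intro y
      have r0 := g.R_nonneg v y
      have r1 := g.R_le v y
      have qy := g.q_le y
      have qy0 := g.q_nonneg y
      split_ifs with hy
      · rw [add_zero]; exact mul_le_mul_of_nonneg_left (hmax y hy) r0
      · have : 0 ≤ g.R v y * g.q v := by positivity
        have : g.R v y * g.q y ≤ 1 * g.q y := mul_le_mul_of_nonneg_right r1 qy0
        linarith
    have c : ∑ y, (if y ∈ W then 0 else n) ≤ η * n * n := by
      have : ∑ y, (if y ∈ W then 0 else n) = Wᶜ.card * n := by
        rw [← Finset.sum_add_sum_compl W]
        rw [Finset.sum_congr rfl (g := fun _ => (0 : ℝ)) (fun x hx => by simp [hx])]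
        rw [Finset.sum_congr (s₁ := Wᶜ) rfl (g := fun _ => n)
          (fun x hx => by simp [Finset.mem_compl.1 hx])]
        simp
      rw [this]; gcongr
    calc OO ≤ ∑ y, g.R v y * g.q y := a
      _ ≤ ∑ y, (g.R v y * g.q v + if y ∈ W then 0 else n) := Finset.sum_le_sum fun y _ => b y
      _ = g.q v * O + ∑ y, (if y ∈ W then 0 else n) := by
        rw [Finset.sum_add_distrib, ← Finset.sum_mul, mul_comm]
      _ ≤ _ := by linarith
  set q := g.q v with hq
  have qn : q ≤ n := by linarith
  have n2 : (n - q) ^ 2 ≤ κ / 4 * n ^ 3 := by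
    calc (n - q) ^ 2 ≤ n ^ 2 := by gcongr; linarith
      _ = 1 * n ^ 2 := by ring
      _ ≤ (κ / 4 * n) * n ^ 2 := by gcongr
      _ = _ := by ring
  have nE : 4 * n * E g (g.clone v) ≤ 12 * η * n ^ 3 := by
    calc 4 * n * E g (g.clone v) ≤ 4 * n * (3 * η * n ^ 2) := by gcongr
      _ = _ := by ring
  have ηk : 26 * η * n ^ 3 = κ * n ^ 3 := by rw [hη]; ring
  have ηn0 : 0 ≤ η * n ^ 3 := by positivity
  -- main inequality
  have M : tau * n ^ 3 - κ * n ^ 3 + η * n ^ 3 ≤ tau * (n - q) ^ 3 + q ^ 2 * I + q * OO := by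
    linarith
  have M1 : tau * n ^ 3 - κ * n ^ 3 ≤ tau * (n - q) ^ 3 + q ^ 2 * (n - q) := by
    have a : q * OO ≤ q * (q * O + η * n ^ 2) := by gcongr
    have b : q * (η * n ^ 2) ≤ n * (η * n ^ 2) := by gcongr
    have c : q ^ 2 * (n - q) = q ^ 2 * I + q ^ 2 * O := by rw [← h_inout]; ring
    linarith
  have tb := tau_bounds
  have bb := bet_bounds
  have sb := sqrt3_bounds
  have ql : 0.1 * n ≤ q := by
    have a : (tau - κ / 4) * n ^ 3 ≤ n * (n * q + η * n ^ 2) :=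
      (h1.trans Tq).trans (by gcongr)
    have b : n ^ 2 * ((tau - κ / 4) * n) ≤ n ^ 2 * (q + η * n) := by linarith
    have c := le_of_mul_le_mul_left b (by positivity)
    have e : (0.1 : ℝ) ≤ tau - κ / 4 - η := by rw [hη]; linarith
    have := mul_le_mul_of_nonneg_right e hn0.le
    linarith
  have sqb : (q - bet * n) ^ 2 ≤ 10 * κ * n ^ 2 := by
    have id := cubic_id n q
    have a : (2 * Real.sqrt 3 / 3) * q * (q - bet * n) ^ 2 ≤ κ * n ^ 3 := by linarith
    have b : 0.1 * n * (q - bet * n) ^ 2 ≤ (2 * Real.sqrt 3 / 3) * q * (q - bet * n) ^ 2 := by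
      apply mul_le_mul_of_nonneg_right _ (sq_nonneg _)
      nlinarith
    have c : (0.1 * n) * (q - bet * n) ^ 2 ≤ (0.1 * n) * (10 * κ * n ^ 2) := by linarith
    exact le_of_mul_le_mul_left c (by positivity)
  have ab : |q - bet * n| ≤ d * n := by
    apply abs_le_of_sq_le_sq _ (by positivity)
    refine sqb.trans ?_
    rw [hκ]
    have : 0 ≤ d ^ 2 * n ^ 2 := by positivity
    nlinarith
  have q6 : 0.6 * n ≤ q := by
    have a := (abs_le.1 ab).1
    have b : d * n ≤ 0.03 * n := by gcongr
    have c : 0.633 * n ≤ bet * n := by gcongr; exact bb.1.le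
    linarith
  have Ob : O ≤ 9 * κ * n := by
    have a : q * OO ≤ q * ((n - q) * O) := by
      have : O ^ 2 ≤ (n - q) * O := by nlinarith
      gcongr
      linarith
    have b := cubic_le n q q0
    have c : q ^ 2 * (n - q) = q ^ 2 * I + q ^ 2 * O := by rw [← h_inout]; ring
    have e : q * (2 * q - n) * O ≤ κ * n ^ 3 := by
      linarith
    have h : 0.12 * n ^ 2 * O ≤ q * (2 * q - n) * O := by
      apply mul_le_mul_of_nonneg_right _ O0
      calc 0.12 * n ^ 2 = (0.6 * n) * (0.2 * n) := by ring
        _ ≤ q * (2 * q - n) := mul_le_mul q6 (by linarith) (by positivity) q0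
    have i : (0.12 * n ^ 2) * O ≤ (0.12 * n ^ 2) * (9 * κ * n) := by
      have : 0 ≤ κ * n ^ 3 := by positivity
      linarith
    exact le_of_mul_le_mul_left i (by positivity)
  refine ⟨A, ?_, ?_⟩
  · rw [hAq]
    exact ab.trans (mul_le_mul_of_nonneg_right d1 hn0.le)
  · refine (E_tri g (g.clone v) _).trans ?_
    have a : 2 * n * O ≤ 2 * n * (9 * κ * n) := by gcongr
    have b : 3 * η + 18 * κ ≤ δ := by
      rw [hη, hκ]; nlinarith
    have c := mul_le_mul_of_nonneg_right b (by positivity : 0 ≤ n ^ 2)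
    linarith

end CG


noncomputable def rem : ℕ → ℕ → ℕ
  | m, 0 => m
  | m, i + 1 => rem (m - kk m) i

namespace CG

/-- the coloured graph associated with a level function -/
noncomputable def lev {V : Type} (l : V → ℕ) : CG V where
  R x y := if l y < l x then 1 else 0
  B x y := if l x = l y then 1 else 0
  R01 x y := by split_ifs <;> simp
  B01 x y := by split_ifs <;> simp
  Bsymm x y := by simp only [eq_comm]
  Bdiag x := by simp
  tri x y := by
    rcases lt_trichotomy (l x) (l y) with h | h | h
    · simp [h, h.ne, h.not_gt]
    · simp [h]
    · simp [h, h.ne', h.not_gt]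

section
variable {V : Type} [Fintype V] [DecidableEq V] (g : CG V)

def Good (l : V → ℕ) : Prop :=
  ∀ i, (Finset.univ.filter fun x => i ≤ l x).card = rem (Fintype.card V) i

def glue (A : Finset V) (l : {x // x ∉ A} → ℕ) (x : V) : ℕ :=
  if h : x ∈ A then 0 else l ⟨x, h⟩ + 1

theorem card_sub (A : Finset V) : Fintype.card {x // x ∉ A} = Fintype.card V - A.card := by
  rw [Fintype.card_subtype_compl]; simp

theorem glue_good (A : Finset V) (hA : A.card = kk (Fintype.card V)) (l : {x // x ∉ A} → ℕ)
    (hl : Good l) : Good (glue A l) := by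
  intro i
  cases i with
  | zero => simp [rem]
  | succ i =>
    have := hl i
    rw [card_sub, hA] at this
    rw [rem, ← this]
    symm
    apply Finset.card_bij (fun (x : {x // x ∉ A}) _ => (x : V))
    · intro a ha
      simp only [Finset.mem_filter, Finset.mem_univ, true_and] at ha ⊢
      unfold glue
      rw [dif_neg a.2]; exact Nat.succ_le_succ ha
    · intro a _ b _ h; exact Subtype.ext h
    · intro b hb
      simp only [Finset.mem_filter, Finset.mem_univ, true_and] at hb
      unfold glue at hb
      by_cases h : b ∈ A
      · rw [dif_pos h] at hb; omega
      · rw [dif_neg h] at hb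
        exact ⟨⟨b, h⟩, by simp; omega, rfl⟩

theorem sum_sub (A : Finset V) (F : V → ℝ) :
    ∑ x : {x // x ∉ A}, F x = ∑ x, (if x ∈ A then 0 else 1) * F x := by
  rw [← Finset.sum_subtype Aᶜ (by simp) F, ← Finset.sum_add_sum_compl A]
  rw [Finset.sum_congr (s₁ := A) rfl (g := fun _ => (0 : ℝ)) (fun x hx => by simp [hx])]
  rw [Finset.sum_const_zero, zero_add]
  exact Finset.sum_congr rfl fun x hx => by simp [Finset.mem_compl.1 hx]

def rest (A : Finset V) : CG {x // x ∉ A} := g.comap Subtype.val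

theorem rest_T (A : Finset V) : (g.rest A).T (fun _ => 1) (fun _ => 1) (fun _ => 1) =
    g.T (fun x => if x ∈ A then 0 else 1) (fun x => if x ∈ A then 0 else 1)
      (fun x => if x ∈ A then 0 else 1) := by
  unfold T
  simp only [rest, comap, one_mul]
  have h1 : ∀ x y : V, ∑ z : {x // x ∉ A}, g.R x y * g.R x z * g.B y z =
      ∑ z, (if z ∈ A then 0 else 1) * (g.R x y * g.R x z * g.B y z) :=
    fun x y => sum_sub A fun z => g.R x y * g.R x z * g.B y z
  simp only [h1]
  have h2 : ∀ x : V, ∑ y : {x // x ∉ A}, ∑ z, (if z ∈ A then 0 else 1) * (g.R x y * g.R x z * g.B y z)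
      = ∑ y, (if y ∈ A then 0 else 1) *
        ∑ z, (if z ∈ A then 0 else 1) * (g.R x y * g.R x z * g.B y z) :=
    fun x => sum_sub A fun y => ∑ z, (if z ∈ A then 0 else 1) * (g.R x y * g.R x z * g.B y z)
  simp only [h2]
  rw [sum_sub A fun x => ∑ y, (if y ∈ A then 0 else 1) *
        ∑ z, (if z ∈ A then 0 else 1) * (g.R x y * g.R x z * g.B y z)]
  simp only [Finset.mul_sum]
  refine Finset.sum_congr rfl fun x _ => Finset.sum_congr rfl fun y _ =>
    Finset.sum_congr rfl fun z _ => by ring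

theorem split_lev_E (A : Finset V) (l : {x // x ∉ A} → ℕ) :
    E (g.split A) (lev (glue A l)) = E (g.rest A) (lev l) := by
  unfold E
  have h0 : ∀ x y : {x // x ∉ A}, |(g.rest A).R x y - (lev l).R x y| =
      |g.R x y - (lev (glue A l)).R x y| := by
    intro x y
    simp only [rest, comap, lev, glue, dif_neg x.2, dif_neg y.2, Subtype.coe_eta]
    simp
  simp only [h0]
  have h2 : ∀ x : V, ∑ y : {x // x ∉ A}, |g.R x y - (lev (glue A l)).R x y|
      = ∑ y, (if y ∈ A then 0 else 1) * |g.R x y - (lev (glue A l)).R x y| :=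
    fun x => sum_sub A fun y => |g.R x y - (lev (glue A l)).R x y|
  simp only [h2]
  rw [sum_sub A fun x => ∑ y, (if y ∈ A then 0 else 1) * |g.R x y - (lev (glue A l)).R x y|]
  simp only [Finset.mul_sum]
  refine Finset.sum_congr rfl fun x _ => Finset.sum_congr rfl fun y _ => ?_
  by_cases hx : x ∈ A <;> by_cases hy : y ∈ A <;> simp [hx, hy, split, lev, glue]

theorem split_E (A A' : Finset V) (h : A ⊆ A') :
    E (g.split A) (g.split A') ≤ 2 * (Fintype.card V : ℝ) * ((A'.card : ℝ) - A.card) := by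
  have e0 : ((A'.card : ℝ) - A.card) = ∑ x, if x ∈ A' \ A then (1 : ℝ) else 0 := by
    have := Finset.card_sdiff_add_card_eq_card h
    rw [← this]; push_cast
    rw [Finset.sum_ite_mem]; simp
  have e1 : 2 * (Fintype.card V : ℝ) * ((A'.card : ℝ) - A.card) =
      ∑ x, ∑ y, ((if x ∈ A' \ A then (1 : ℝ) else 0) + if y ∈ A' \ A then (1 : ℝ) else 0) := by
    simp only [Finset.sum_add_distrib, ← e0]
    simp only [Finset.sum_const, ← Finset.smul_sum, ← e0]
    simp only [Finset.card_univ, nsmul_eq_mul]; ring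
  rw [e1]; unfold E
  refine Finset.sum_le_sum fun x _ => Finset.sum_le_sum fun y _ => ?_
  have hx := @h x
  have hy := @h y
  have a : |g.R x y| ≤ 1 := abs_le.2 ⟨by linarith [g.R_nonneg x y], g.R_le x y⟩
  have b : |g.R x y - 1| ≤ 1 := abs_le.2 ⟨by linarith [g.R_nonneg x y], by linarith [g.R_le x y]⟩
  by_cases h1 : x ∈ A <;> by_cases h2 : y ∈ A <;> by_cases h3 : x ∈ A' <;> by_cases h4 : y ∈ A' <;>
  simp [h1, h2, h3, h4, split] at hx hy ⊢ <;> linarith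

theorem E_symm (g g' : CG V) : E g g' = E g' g := by
  unfold E
  exact Finset.sum_congr rfl fun x _ => Finset.sum_congr rfl fun y _ => abs_sub_comm _ _

theorem E_le (g g' : CG V) : E g g' ≤ (Fintype.card V : ℝ) ^ 2 := by
  unfold E
  calc _ ≤ ∑ _x : V, ∑ _y : V, (1 : ℝ) := by
        refine Finset.sum_le_sum fun x _ => Finset.sum_le_sum fun y _ => ?_
        have := g.R_nonneg x y
        have := g.R_le x y
        have := g'.R_nonneg x y
        have := g'.R_le x y
        rw [abs_le]; constructor <;> linarith
    _ = _ := by simp [sq]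

end

theorem ex_good (N : ℕ) : ∀ (V : Type) [Fintype V] [DecidableEq V], Fintype.card V = N →
    ∃ l : V → ℕ, Good l := by
  induction N using Nat.strong_induction_on with
  | _ N ih =>
    intro V _ _ hV
    rcases Nat.eq_zero_or_pos N with h | h
    · subst h
      refine ⟨fun _ => 0, fun i => ?_⟩
      have : ∀ i, rem 0 i = 0 := by
        intro i
        induction i with
        | zero => rfl
        | succ i ih => rw [rem]; simpa using ih
      rw [hV, this]
      have := Fintype.card_eq_zero_iff.1 hV
      simp
    · have hk := kk_spec N h
      obtain ⟨A, -, hA⟩ := Finset.exists_subset_card_eq (s := (Finset.univ : Finset V)) (n := kk N)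
        (by rw [Finset.card_univ, hV]; exact hk.2.1)
      obtain ⟨l, hl⟩ := ih (N - kk N) (by omega) {x // x ∉ A} (by rw [card_sub, hV, hA])
      exact ⟨glue A l, glue_good A (by rw [hA, hV]) l hl⟩

theorem lemD (d : ℕ) : ∀ δ : ℝ, 0 < δ → ∃ ε : ℝ, 0 < ε ∧
    ∀ (V : Type) [Fintype V] [DecidableEq V] (g : CG V), g.Near ε →
    ∃ l : V → ℕ, Good l ∧ E g (lev l) ≤ ((1 / 2) ^ d + δ) * (Fintype.card V : ℝ) ^ 2 := by
  induction d with
  | zero =>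
    intro δ hδ
    refine ⟨1, one_pos, fun V _ _ g _ => ?_⟩
    obtain ⟨l, hl⟩ := ex_good _ V rfl
    refine ⟨l, hl, (E_le _ _).trans ?_⟩
    rw [pow_zero]
    nlinarith [sq_nonneg (Fintype.card V : ℝ)]
  | succ d ih =>
    intro δ hδ
    obtain ⟨ε₁, hε₁, H1⟩ := ih δ hδ
    set δ₃ := min (δ / 2) (ε₁ / 512) with hδ₃
    have δ₃0 : 0 < δ₃ := by positivity
    obtain ⟨ε₂, hε₂, H2⟩ := lemS (δ₃ / 6) (by positivity)
    obtain ⟨m₀, hm₀⟩ := kk_near (min (δ₃ / 6) 0.05) (by positivity)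
    refine ⟨min ε₂ (min (ε₁ / 128) (1 / (m₀ + 1))), by positivity, fun V _ _ g hg => ?_⟩
    obtain ⟨A, hA1, hA2⟩ := H2 V g (hg.mono (min_le_left _ _))
    obtain ⟨h1, h2⟩ := hg.mono ((min_le_right _ _).trans (min_le_left _ _))
    obtain ⟨-, h3⟩ := hg.mono ((min_le_right _ _).trans (min_le_right _ _))
    have hm := hm₀ (Fintype.card V) (by
      rw [div_mul_eq_mul_div, one_mul, le_div_iff₀ (by positivity)] at h3
      have : m₀ + 1 ≤ Fintype.card V := by exact_mod_cast (by linarith : (m₀ : ℝ) + 1 ≤ Fintype.card V)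
      omega)
    have hkle := kk_le (Fintype.card V)
    set N := Fintype.card V with hN
    set n : ℝ := (N : ℝ) with hn
    have hn0 : 0 < n := by
      by_contra hc
      push Not at hc
      nlinarith
    set k : ℝ := (kk N : ℝ) with hk
    have bb := bet_bounds
    have tb := tau_bounds
    have d4 : min (δ₃ / 6) 0.05 * n ≤ 0.05 * n := by gcongr; exact min_le_right _ _
    have d5 : min (δ₃ / 6) 0.05 * n ≤ δ₃ / 6 * n := by gcongr; exact min_le_left _ _
    have hb1 : bet * n ≤ 0.634 * n := by gcongr; exact bb.2.le
    have hb2 : 0.633 * n ≤ bet * n := by gcongr; exact bb.1.le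
    rw [abs_le] at hm hA1
    have k1 : n - k ≤ 0.7 * n := by linarith
    have k2 : 0.25 * n ≤ n - k := by linarith
    -- adjust A
    obtain ⟨A', hA', hE⟩ : ∃ A' : Finset V, A'.card = kk N ∧
        E (g.split A) (g.split A') ≤ 2 * n * (δ₃ / 3 * n) := by
      rcases le_total (kk N) A.card with hc | hc
      · obtain ⟨A', hs, hcard⟩ := Finset.exists_subset_card_eq hc
        refine ⟨A', hcard, ?_⟩
        rw [E_symm]
        refine (split_E g A' A hs).trans ?_
        rw [hcard]
        apply mul_le_mul_of_nonneg_left _ (by positivity)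
        linarith
      · obtain ⟨A', hs, -, hcard⟩ := Finset.exists_subsuperset_card_eq (Finset.subset_univ A) hc
          (by rw [Finset.card_univ]; exact hkle)
        refine ⟨A', hcard, ?_⟩
        refine (split_E g A A' hs).trans ?_
        rw [hcard]
        apply mul_le_mul_of_nonneg_left _ (by positivity)
        linarith
    have E3 : E g (g.split A') ≤ δ₃ * n ^ 2 := by
      have := E_tri g (g.split A) (g.split A')
      nlinarith [sq_nonneg n]
    have hcs : (Fintype.card {x // x ∉ A'} : ℝ) = n - k := by
      rw [card_sub, hA', Nat.cast_sub hkle]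
    have hk0 : 0 ≤ k := by positivity
    have hnear : (g.rest A').Near ε₁ := by
      have td := T_diff g (g.split A')
      rw [split_T, ← rest_T, hA'] at td
      have c := cubic_le n k hk0
      unfold Near
      rw [hcs]
      refine ⟨?_, by nlinarith⟩
      have e4 : 4 * n * E g (g.split A') ≤ ε₁ / 128 * n ^ 3 := by
        calc 4 * n * E g (g.split A') ≤ 4 * n * (δ₃ * n ^ 2) := by gcongr
          _ ≤ 4 * n * ((ε₁ / 512) * n ^ 2) := by gcongr; exact min_le_right _ _
          _ = _ := by ring
      have e5 : ε₁ * (0.25 * n) ^ 3 ≤ ε₁ * (n - k) ^ 3 := by gcongr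
      have e6 : ε₁ * (0.25 * n) ^ 3 = ε₁ / 64 * n ^ 3 := by ring
      change _ ≤ _ + k ^ 2 * (n - k) + 4 * n * _ at td
      linarith
    obtain ⟨l, hl, hEl⟩ := H1 _ (g.rest A') hnear
    rw [hcs] at hEl
    refine ⟨glue A' l, glue_good A' hA' l hl, ?_⟩
    have t := E_tri g (g.split A') (lev (glue A' l))
    rw [split_lev_E] at t
    have e7 : (n - k) ^ 2 ≤ 1 / 2 * n ^ 2 := by
      have : (n - k) ^ 2 ≤ (0.7 * n) ^ 2 := by gcongr; linarith
      nlinarith [sq_nonneg n]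
    have e8 : ((1 / 2) ^ d + δ) * (n - k) ^ 2 ≤ ((1 / 2) ^ d + δ) * (1 / 2 * n ^ 2) := by gcongr
    have e9 : δ₃ * n ^ 2 ≤ δ / 2 * n ^ 2 := by gcongr; exact min_le_left _ _
    rw [pow_succ]
    linarith

end CG


namespace CG

theorem ext' {V : Type} {g g' : CG V} (h : ∀ x y, g.R x y = g'.R x y)
    (h' : ∀ x y, g.B x y = g'.B x y) : g = g' := by
  cases g; cases g'
  simp only [mk.injEq]
  exact ⟨funext fun x => funext fun y => h x y, funext fun x => funext fun y => h' x y⟩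

section
variable {V : Type} [Fintype V] [DecidableEq V] (g : CG V)

noncomputable def TS (g : CG V) : ℝ := g.T (fun _ => 1) (fun _ => 1) (fun _ => 1) -
  g.S (fun _ => 1) (fun _ => 1)

theorem split_TS (A : Finset V) : (g.split A).TS = (g.rest A).TS +
    (A.card : ℝ) * (A.card - 1) * ((Fintype.card V : ℝ) - A.card) := by
  have e0 : (A.card : ℝ) = ∑ y, if y ∈ A then (1 : ℝ) else 0 := by simp
  have e00 : (Fintype.card V : ℝ) - A.card = ∑ y, if y ∈ A then (0 : ℝ) else 1 := by
    have : ∀ y, (if y ∈ A then (0 : ℝ) else 1) = 1 - if y ∈ A then (1 : ℝ) else 0 := by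
      intro y; split_ifs <;> norm_num
    simp only [this, Finset.sum_sub_distrib, ← e0]; simp
  have e1 : ((Fintype.card V : ℝ) - A.card) * (A.card : ℝ) = ∑ x, ∑ y,
      (if x ∈ A then (0 : ℝ) else 1) * (if y ∈ A then (1 : ℝ) else 0) := by
    rw [e00, e0, Finset.sum_mul_sum]
  have e2 : (g.rest A).S (fun _ => 1) (fun _ => 1) = ∑ x, ∑ y, (if x ∈ A then 0 else 1) *
      ((if y ∈ A then 0 else 1) * g.R x y) := by
    unfold S
    simp only [rest, comap, one_mul]
    have h2 : ∀ x : V, ∑ y : {x // x ∉ A}, g.R x y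
        = ∑ y, (if y ∈ A then 0 else 1) * g.R x y :=
      fun x => sum_sub A fun y => g.R x y
    simp only [h2]
    rw [sum_sub A fun x => ∑ y, (if y ∈ A then 0 else 1) * g.R x y]
    simp only [Finset.mul_sum]
  have e3 : (g.split A).S (fun _ => 1) (fun _ => 1) = (g.rest A).S (fun _ => 1) (fun _ => 1) +
      ((Fintype.card V : ℝ) - A.card) * (A.card : ℝ) := by
    rw [e2, e1]; unfold S
    simp only [← Finset.sum_add_distrib]
    refine Finset.sum_congr rfl fun x _ => Finset.sum_congr rfl fun y _ => ?_
    by_cases hx : x ∈ A <;> by_cases hy : y ∈ A <;> simp [hx, hy, split]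
  unfold TS
  rw [split_T, e3, rest_T]
  ring

end

theorem rem_succ (n i : ℕ) : rem n (i + 1) = rem n i - kk (rem n i) := by
  induction i generalizing n with
  | zero => rfl
  | succ i ih => rw [rem, ih]; rfl

theorem lev_TS (N : ℕ) : ∀ (V : Type) [Fintype V] [DecidableEq V] (l : V → ℕ), Fintype.card V = N →
    Good l → (lev l).TS = 2 * (f N : ℝ) := by
  induction N using Nat.strong_induction_on with
  | _ N ih =>
    intro V _ _ l hV hl
    rcases Nat.eq_zero_or_pos N with h | h
    · subst h
      have := Fintype.card_eq_zero_iff.1 hV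
      simp [TS, T, S, f]
    · obtain ⟨k1, k2, k3⟩ := kk_spec N h
      set A := Finset.univ.filter fun x => l x = 0 with hA
      have hAm : ∀ x, x ∈ A ↔ l x = 0 := by simp [hA]
      have hAc : A.card = kk N := by
        have h0 := hl 1
        have h1 : A.card + (Finset.univ.filter fun x => 1 ≤ l x).card = Fintype.card V := by
          rw [← Finset.card_univ, ← Finset.card_filter_add_card_filter_not (s := Finset.univ)
            (fun x => l x = 0)]
          congr 2
          ext x; simp; omega
        rw [h0, hV, rem, rem] at h1
        omega
      have e : lev l = (lev l).split A := by
        apply ext'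
        · intro x y
          simp only [lev, split, hAm]
          split_ifs <;> first | rfl | omega
        · intro x y
          simp only [lev, split, hAm]
          split_ifs <;> first | rfl | omega
      have e' : (lev l).rest A = lev (fun x : {x // x ∉ A} => l x - 1) := by
        apply ext'
        · intro x y
          have hx := (hAm x).not.1 x.2
          have hy := (hAm y).not.1 y.2
          simp only [rest, comap, lev]
          congr 1
          apply propext; omega
        · intro x y
          have hx := (hAm x).not.1 x.2
          have hy := (hAm y).not.1 y.2
          simp only [rest, comap, lev]
          congr 1
          apply propext; omega
      have hc : Fintype.card {x // x ∉ A} = N - kk N := by rw [card_sub, hV, hAc]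
      have hg : Good (fun x : {x // x ∉ A} => l x - 1) := by
        intro i
        have := hl (i + 1)
        rw [hV, rem] at this
        rw [hc, ← this]
        apply Finset.card_bij (fun (x : {x // x ∉ A}) _ => (x : V))
        · intro a ha
          have hx := (hAm a).not.1 a.2
          simp only [Finset.mem_filter, Finset.mem_univ, true_and] at ha ⊢
          omega
        · intro a _ b _ h; exact Subtype.ext h
        · intro b hb
          simp only [Finset.mem_filter, Finset.mem_univ, true_and] at hb
          have hb' : b ∉ A := by rw [hAm]; omega
          refine ⟨⟨b, hb'⟩, ?_, rfl⟩
          simp only [Finset.mem_filter, Finset.mem_univ, true_and]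
          omega
      have := ih (N - kk N) (by omega) _ _ hc hg
      rw [e, split_TS, e', this, hAc, hV, k3]
      push_cast
      rw [Nat.cast_sub k2, Nat.cast_choose_two]
      ring

end CG

section
variable {V : Type} [Fintype V] [DecidableEq V]

open Classical in
noncomputable def toCG (G : ColouredGraph V) : CG V where
  R x y := if x ≠ y ∧ G.Red x y then 1 else 0
  B x y := if x = y ∨ G.Blue x y then 1 else 0
  R01 x y := by split_ifs <;> simp
  B01 x y := by split_ifs <;> simp
  Bsymm x y := by
    congr 1
    apply propext
    constructor <;> rintro (h | h)
    · exact Or.inl h.symm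
    · exact Or.inr (G.blue_symm _ _ h)
    · exact Or.inl h.symm
    · exact Or.inr (G.blue_symm _ _ h)
  Bdiag x := by simp
  tri x y := by
    by_cases h : x = y
    · simp [h]
    · rcases G.trichotomy x y h with ⟨a, b, c⟩ | ⟨a, b, c⟩ | ⟨a, b, c⟩ <;>
        simp [h, a, b, c, Ne.symm h]

def levG (l : V → ℕ) : ColouredGraph V where
  Blue x y := l x = l y
  Red x y := l y < l x
  blue_symm x y h := h.symm
  trichotomy x y _ := by omega

theorem toCG_levG (l : V → ℕ) : toCG (levG l) = CG.lev l := by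
  apply CG.ext'
  · intro x y
    simp only [toCG, levG, CG.lev]
    by_cases h : x = y <;> simp [h]
  · intro x y
    simp only [toCG, levG, CG.lev]
    by_cases h : x = y <;> simp [h]

open Classical in
theorem cherry_TS (G : ColouredGraph V) : 2 * (cherryCount G : ℝ) = (toCG G).TS := by
  set P : Finset (V × V × V) := Finset.univ.filter fun p =>
    p.1 ≠ p.2.1 ∧ p.1 ≠ p.2.2 ∧ p.2.1 ≠ p.2.2 ∧ G.Red p.1 p.2.1 ∧ G.Red p.1 p.2.2 ∧
      G.Blue p.2.1 p.2.2 with hP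
  have e1 : (toCG G).TS = P.card := by
    rw [hP, Finset.card_filter]
    push_cast
    simp only [Fintype.sum_prod_type]
    unfold CG.TS CG.T CG.S
    rw [← Finset.sum_sub_distrib]
    refine Finset.sum_congr rfl fun x _ => ?_
    rw [← Finset.sum_sub_distrib]
    refine Finset.sum_congr rfl fun y _ => ?_
    have : (1 : ℝ) * 1 * (toCG G).R x y = ∑ z, if y = z then (toCG G).R x y else 0 := by simp
    rw [this, ← Finset.sum_sub_distrib]
    refine Finset.sum_congr rfl fun z _ => ?_
    simp only [toCG]
    by_cases h1 : y = z
    · subst h1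
      by_cases h2 : x ≠ y ∧ G.Red x y <;> simp [h2]
    · by_cases h2 : x ≠ y ∧ G.Red x y <;> by_cases h3 : x ≠ z ∧ G.Red x z <;>
      by_cases h4 : G.Blue y z <;> simp [h1, h2, h3, h4] <;> tauto
  set C : Finset (Finset V) := Finset.univ.filter fun e => IsCherry G e with hC
  have e2 : cherryCount G = C.card := by
    unfold cherryCount
    rw [hC, ← Set.ncard_coe_finset]
    congr 1
    ext e; simp
  have e3 : P.card = ∑ e ∈ C, (P.filter fun p => ({p.1, p.2.1, p.2.2} : Finset V) = e).card := by
    apply Finset.card_eq_sum_card_fiberwise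
    intro p hp
    simp only [hP, Finset.coe_filter, Finset.mem_univ, true_and, Set.mem_setOf_eq] at hp
    simp only [hC, Finset.coe_filter, Finset.mem_univ, true_and, Set.mem_setOf_eq]
    exact ⟨p.1, p.2.1, p.2.2, hp.1, hp.2.1, hp.2.2.1, rfl, hp.2.2.2⟩
  have e4 : ∀ e ∈ C, (P.filter fun p => ({p.1, p.2.1, p.2.2} : Finset V) = e).card = 2 := by
    intro e he
    simp only [hC, Finset.mem_filter, Finset.mem_univ, true_and] at he
    obtain ⟨x, y, z, hxy, hxz, hyz, rfl, r1, r2, b⟩ := he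
    have : (P.filter fun p => ({p.1, p.2.1, p.2.2} : Finset V) = {x, y, z}) =
        {(x, y, z), (x, z, y)} := by
      ext ⟨x', y', z'⟩
      simp only [hP, Finset.mem_filter, Finset.mem_univ, true_and, Finset.mem_insert,
        Finset.mem_singleton, Prod.mk.injEq]
      have t1 := G.trichotomy x y hxy
      have t2 := G.trichotomy x z hxz
      have t3 := G.trichotomy y z hyz
      have b' := G.blue_symm _ _ b
      constructor
      · rintro ⟨⟨h1, h2, h3, h4, h5, h6⟩, h7⟩
        have m1 : x' ∈ ({x, y, z} : Finset V) := by rw [← h7]; simp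
        have m2 : y' ∈ ({x, y, z} : Finset V) := by rw [← h7]; simp
        have m3 : z' ∈ ({x, y, z} : Finset V) := by rw [← h7]; simp
        simp only [Finset.mem_insert, Finset.mem_singleton] at m1 m2 m3
        clear h7
        rcases m1 with rfl | rfl | rfl <;> rcases m2 with rfl | rfl | rfl <;>
        rcases m3 with rfl | rfl | rfl <;> tauto
      · rintro (⟨rfl, rfl, rfl⟩ | ⟨rfl, rfl, rfl⟩)
        · exact ⟨⟨hxy, hxz, hyz, r1, r2, b⟩, rfl⟩
        · refine ⟨⟨hxz, hxy, hyz.symm, r2, r1, b'⟩, ?_⟩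
          ext t; simp; tauto
    rw [this, Finset.card_pair]
    simp [hyz]
  rw [e1, e2, e3, Finset.sum_congr rfl e4]
  simp [mul_comm]

open Classical in
theorem diff_le (G G' : ColouredGraph V) : ((diffPairs G G').ncard : ℝ) ≤ CG.E (toCG G) (toCG G') := by
  set D : Finset (V × V) := Finset.univ.filter fun p => (toCG G).R p.1 p.2 ≠ (toCG G').R p.1 p.2
    with hD
  have h1 : diffPairs G G' ⊆ ((D.image fun p => ({p.1, p.2} : Finset V)) : Set (Finset V)) := by
    rintro e ⟨x, y, hxy, rfl, h⟩
    have : (x, y) ∈ D ∨ (y, x) ∈ D := by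
      simp only [hD, Finset.mem_filter, Finset.mem_univ, true_and]
      by_contra hc
      push Not at hc
      apply h
      obtain ⟨a, b⟩ := hc
      simp only [toCG, hxy, hxy.symm, ne_eq, not_false_eq_true, true_and] at a b
      have t1 := G.trichotomy x y hxy
      have t2 := G'.trichotomy x y hxy
      have a' : G.Red x y ↔ G'.Red x y := by
        by_cases u : G.Red x y <;> by_cases w : G'.Red x y <;> simp [u, w] at a ⊢
      have b' : G.Red y x ↔ G'.Red y x := by
        by_cases u : G.Red y x <;> by_cases w : G'.Red y x <;> simp [u, w] at b ⊢
      tauto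
    rw [Finset.mem_coe, Finset.mem_image]
    rcases this with h | h
    · exact ⟨_, h, rfl⟩
    · exact ⟨_, h, Finset.pair_comm _ _⟩
  have h2 : (diffPairs G G').ncard ≤ D.card := by
    refine (Set.ncard_le_ncard h1 (Finset.finite_toSet _)).trans ?_
    rw [Set.ncard_coe_finset]
    exact Finset.card_image_le
  have h3 : (D.card : ℝ) ≤ CG.E (toCG G) (toCG G') := by
    rw [hD, Finset.card_filter]
    push_cast
    rw [Fintype.sum_prod_type]
    unfold CG.E
    refine Finset.sum_le_sum fun x _ => Finset.sum_le_sum fun y _ => ?_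
    rcases (toCG G).R01 x y with h | h <;> rcases (toCG G').R01 x y with h' | h' <;>
      simp [h, h']
  exact le_trans (by exact_mod_cast h2) h3

end

theorem rem_zero_ex (n : ℕ) : ∃ i, rem n i = 0 := by
  induction n using Nat.strong_induction_on with
  | _ n ih =>
    rcases Nat.eq_zero_or_pos n with h | h
    · exact ⟨0, h⟩
    · obtain ⟨k1, k2, -⟩ := kk_spec n h
      obtain ⟨i, hi⟩ := ih (n - kk n) (by omega)
      exact ⟨i + 1, hi⟩

theorem rem_le (n i : ℕ) : rem n i ≤ n := by
  induction i with
  | zero => exact le_refl n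
  | succ i ih => rw [CG.rem_succ]; omega



theorem TS_le {V : Type} [Fintype V] [DecidableEq V] (g : CG V) :
    g.TS ≤ 2 * (f (Fintype.card V) : ℝ) := by
  have := g.upper_aux _ (fun _ => 1) rfl
  simpa [CG.TS] using this

theorem TS_le_T {V : Type} [Fintype V] [DecidableEq V] (g : CG V) :
    g.TS ≤ g.T (fun _ => 1) (fun _ => 1) (fun _ => 1) := by
  have : 0 ≤ g.S (fun _ => 1) (fun _ => 1) := by
    unfold CG.S
    exact Finset.sum_nonneg fun x _ => Finset.sum_nonneg fun y _ => by
      have := g.R_nonneg x y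
      simpa using this
  unfold CG.TS
  linarith

open CG in
theorem level_card {V : Type} [Fintype V] [DecidableEq V] (l : V → ℕ) (hl : Good l) (i : ℕ) :
    (Finset.univ.filter fun x => l x = i).card = kk (rem (Fintype.card V) i) := by
  have h1 := hl i
  have h2 := hl (i + 1)
  rw [rem_succ] at h2
  have h3 := kk_le (rem (Fintype.card V) i)
  have h4 : (Finset.univ.filter fun x => i ≤ l x).card
      = (Finset.univ.filter fun x => l x = i).card
        + (Finset.univ.filter fun x => i + 1 ≤ l x).card := by
    rw [← Finset.card_union_of_disjoint]
    · congr 1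
      ext x; simp; omega
    · rw [Finset.disjoint_left]
      intro x; simp; omega
  omega

/-- Full stability: if `G` is a coloured graph on `n` vertices with
`c(G) ≥ f(n) − ε₁n³`, then there is a coloured graph `G'` on the same vertex set with
`c(G') ≥ c(G)`, differing from `G` on at most `ε₂n²` pairs, whose vertex set is
partitioned into nonempty sets `Q 0, …, Q (t−1)` of weakly decreasing sizes, blue inside
each part, red between parts directed towards the earlier part, and with
`||Q i| − β·|Q i ∪ … ∪ Q (t−1)|| ≤ ε₂n` for every `i`, where `β = (3 − √3)/2`. -/
theorem full_stability :
    ∃ ε₂' : ℝ, 0 < ε₂' ∧ ∀ ε₂ : ℝ, 0 < ε₂ → ε₂ < ε₂' →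
      ∃ ε₁' : ℝ, 0 < ε₁' ∧ ∀ ε₁ : ℝ, 0 < ε₁ → ε₁ < ε₁' →
        ∃ n₀ : ℕ, ∀ n : ℕ, n₀ ≤ n → ∀ G : ColouredGraph (Fin n),
          (cherryCount G : ℝ) ≥ (f n : ℝ) - ε₁ * (n : ℝ) ^ 3 →
          ∃ G' : ColouredGraph (Fin n),
            cherryCount G' ≥ cherryCount G ∧
            ((diffPairs G G').ncard : ℝ) ≤ ε₂ * (n : ℝ) ^ 2 ∧
            ∃ t : ℕ, ∃ Q : Fin t → Finset (Fin n),
              (∀ i, (Q i).Nonempty) ∧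
              (∀ v : Fin n, ∃! i, v ∈ Q i) ∧
              (∀ i j : Fin t, i ≤ j → (Q j).card ≤ (Q i).card) ∧
              (∀ i : Fin t, ∀ x ∈ Q i, ∀ y ∈ Q i, x ≠ y → G'.Blue x y) ∧
              (∀ i j : Fin t, i < j → ∀ x ∈ Q i, ∀ y ∈ Q j, G'.Red y x) ∧
              (∀ i : Fin t,
                |((Q i).card : ℝ) -
                    (3 - Real.sqrt 3) / 2 *
                      (((Finset.univ.filter fun j => i ≤ j).biUnion Q).card : ℝ)|
                  ≤ ε₂ * (n : ℝ)) := by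
  refine ⟨1, one_pos, fun ε₂ h2 _ => ?_⟩
  obtain ⟨d, hd⟩ := exists_pow_lt_of_lt_one (half_pos h2) (by norm_num : (1 / 2 : ℝ) < 1)
  obtain ⟨ε, hε, H⟩ := CG.lemD d (ε₂ / 2) (half_pos h2)
  obtain ⟨m₀, hm₀⟩ := kk_near ε₂ h2
  refine ⟨ε / 4, by positivity, fun ε₁ h1 h1' => ?_⟩
  obtain ⟨N, hN⟩ := exists_nat_gt (4 / ε + m₀ / ε₂)
  refine ⟨N, fun n hn G hG => ?_⟩
  have hnr : 4 / ε + m₀ / ε₂ < (n : ℝ) := hN.trans_le (by exact_mod_cast hn)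
  have p1 : 0 < 4 / ε := by positivity
  have p2 : 0 ≤ m₀ / ε₂ := by positivity
  have n4 : 4 ≤ ε * n := by
    have : 4 / ε ≤ n := by linarith
    rw [div_le_iff₀ hε] at this; linarith
  have nm : (m₀ : ℝ) ≤ ε₂ * n := by
    have : m₀ / ε₂ ≤ n := by linarith
    rw [div_le_iff₀ h2] at this; linarith
  have hc := cherry_TS G
  have hfl := f_lower n
  have hT := TS_le_T (toCG G)
  have hnear : (toCG G).Near ε := by
    constructor
    · rw [Fintype.card_fin]
      have a : 4 * (n : ℝ) ^ 2 ≤ ε * n * n ^ 2 := by gcongr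
      have b : ε₁ * (n : ℝ) ^ 3 ≤ ε / 4 * n ^ 3 := by gcongr
      nlinarith
    · rw [Fintype.card_fin]; linarith
  obtain ⟨l, hl, hE⟩ := H (Fin n) (toCG G) hnear
  have hcard := Fintype.card_fin n
  refine ⟨levG l, ?_, ?_, ?_⟩
  · have a := cherry_TS (levG l)
    rw [toCG_levG, CG.lev_TS n (Fin n) l hcard hl] at a
    have b := TS_le (toCG G)
    rw [hcard] at b
    have : (cherryCount G : ℝ) ≤ cherryCount (levG l) := by linarith
    exact_mod_cast this
  · have a := diff_le G (levG l)
    rw [toCG_levG] at a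
    rw [hcard] at hE
    have b : ((1 / 2) ^ d + ε₂ / 2) * (n : ℝ) ^ 2 ≤ ε₂ * (n : ℝ) ^ 2 := by
      gcongr; linarith
    linarith
  · have hlc := level_card l hl
    have hgood : ∀ i, (Finset.univ.filter fun x => i ≤ l x).card = rem n i := by
      intro i; have := hl i; rwa [hcard] at this
    rw [hcard] at hlc
    have hex := rem_zero_ex n
    classical
    have hlt : ∀ v, l v < Nat.find hex := by
      intro v
      by_contra hv
      push Not at hv
      have a := hgood (Nat.find hex)
      rw [Nat.find_spec hex, Finset.card_eq_zero] at a
      have : v ∈ (Finset.univ.filter fun x => Nat.find hex ≤ l x) := by simpa using hv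
      rw [a] at this
      simp at this
    have hanti : Antitone fun i => kk (rem n i) := by
      apply antitone_nat_of_succ_le
      intro i
      rw [CG.rem_succ]
      exact kk_mono _
    refine ⟨Nat.find hex, fun i => Finset.univ.filter fun x => l x = i, ?_, ?_, ?_, ?_, ?_, ?_⟩
    · intro i
      rw [← Finset.card_pos, hlc]
      have := Nat.find_min hex i.2
      exact (kk_spec _ (Nat.pos_of_ne_zero this)).1
    · intro v
      refine ⟨⟨l v, hlt v⟩, by simp, ?_⟩
      intro j hj
      simp only [Finset.mem_filter, Finset.mem_univ, true_and] at hj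
      exact Fin.ext hj.symm
    · intro i j hij
      simp only [hlc]
      exact hanti hij
    · intro i x hx y hy _
      simp only [Finset.mem_filter, Finset.mem_univ, true_and] at hx hy
      exact hx.trans hy.symm
    · intro i j hij x hx y hy
      simp only [Finset.mem_filter, Finset.mem_univ, true_and] at hx hy
      change l x < l y
      rw [hx, hy]; exact hij
    · intro i
      have e : ((Finset.univ.filter fun j => i ≤ j).biUnion
          fun i : Fin (Nat.find hex) => Finset.univ.filter fun x => l x = i)
          = Finset.univ.filter fun x => (i : ℕ) ≤ l x := by
        ext x
        simp only [Finset.mem_biUnion, Finset.mem_filter, Finset.mem_univ, true_and]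
        constructor
        · rintro ⟨j, hj, hx⟩
          rw [hx]; exact hj
        · intro h
          exact ⟨⟨l x, hlt x⟩, h, rfl⟩
      rw [e, hgood, hlc]
      change |(kk (rem n i) : ℝ) - bet * (rem n i : ℝ)| ≤ _
      have hr : (rem n i : ℝ) ≤ n := by exact_mod_cast rem_le n i
      have hk : (kk (rem n i) : ℝ) ≤ rem n i := by exact_mod_cast kk_le _
      have hk0 : (0 : ℝ) ≤ kk (rem n i) := by positivity
      have hr0 : (0 : ℝ) ≤ rem n i := by positivity
      have bb := bet_bounds
      rcases Nat.lt_or_ge (rem n i) m₀ with h | h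
      · have h' : (rem n i : ℝ) ≤ m₀ := by exact_mod_cast h.le
        rw [abs_le]
        constructor <;> nlinarith
      · refine (hm₀ _ h).trans ?_
        gcongr
end

section
/- For every ε > 0 there exists ℓ such that the following holds for every n: every 3-uniform hypergraph H on n vertices has a subhypergraph H' on the same vertex set (i.e., a hypergraph whose edge set is a subset of that of H) with e(H') ≥ e(H) − εn³ and diameter at most ℓ. -/
/-- `v` (restricted to indices `0, …, m − 1`) is a pseudopath of order `m` in `H` from the
ordered pair `(x, y)` to the ordered pair `(z, w)`. -/
def IsPseudopathFrom {V : Type} [DecidableEq V] (H : Finset (Finset V)) (m : ℕ)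
    (v : ℕ → V) (x y z w : V) : Prop :=
  (∀ i : ℕ, i + 3 ≤ m → ({v i, v (i + 1), v (i + 2)} : Finset V) ∈ H) ∧
  v 0 = x ∧ v 1 = y ∧ v (m - 2) = z ∧ v (m - 1) = w

/-- `H` has diameter at most `ℓ`: whenever there is a pseudopath from `(x, y)` to `(z, w)`
(with `x ≠ y`, `z ≠ w`), there is one of order at most `ℓ`. -/
def DiamAtMost {V : Type} [DecidableEq V] (H : Finset (Finset V)) (ℓ : ℕ) : Prop :=
  ∀ x y z w : V, x ≠ y → z ≠ w →
    (∃ m : ℕ, ∃ v : ℕ → V, 2 ≤ m ∧ IsPseudopathFrom H m v x y z w) →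
    (∃ m : ℕ, ∃ v : ℕ → V, 2 ≤ m ∧ m ≤ ℓ ∧ IsPseudopathFrom H m v x y z w)

/-- Vertices completing `x, y` to an edge. -/
def linkSet {n : ℕ} (K : Finset (Finset (Fin n))) (x y : Fin n) : Finset (Fin n) :=
  Finset.univ.filter fun z => ({x, y, z} : Finset (Fin n)) ∈ K

/-- Ordered pairs with positive codegree. -/
def shadowSet {n : ℕ} (K : Finset (Finset (Fin n))) : Finset (Fin n × Fin n) :=
  Finset.univ.filter fun p => (linkSet K p.1 p.2).Nonempty

/-- Pairs reachable in two steps from `(x, y)`. -/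
def ballSet {n : ℕ} (K : Finset (Finset (Fin n))) (x y : Fin n) : Finset (Fin n × Fin n) :=
  Finset.univ.filter fun p => p.1 ∈ linkSet K x y ∧ p.2 ∈ linkSet K y p.1

theorem mem_linkSet {n : ℕ} {K : Finset (Finset (Fin n))} {x y z : Fin n} :
    z ∈ linkSet K x y ↔ ({x, y, z} : Finset (Fin n)) ∈ K := by simp [linkSet]

theorem mem_shadowSet {n : ℕ} {K : Finset (Finset (Fin n))} {x y : Fin n} :
    (x, y) ∈ shadowSet K ↔ ∃ z, ({x, y, z} : Finset (Fin n)) ∈ K := by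
  simp [shadowSet, Finset.Nonempty, mem_linkSet]

/-- Cleaning: remove few edges so that all positive codegrees are at least `c`. -/
theorem exists_clean {n : ℕ} (H : Finset (Finset (Fin n))) (c : ℝ) (hc : 0 ≤ c) :
    ∃ K ⊆ H, (K.card : ℝ) ≥ H.card - c * (n : ℝ) ^ 2 ∧
      ∀ x y z : Fin n, ({x, y, z} : Finset (Fin n)) ∈ K → c ≤ (linkSet K x y).card := by
  obtain ⟨K, hK, hmax⟩ := Finset.exists_max_image H.powerset
    (fun K => (K.card : ℝ) - c * (shadowSet K).card) ⟨H, by simp⟩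
  rw [Finset.mem_powerset] at hK
  refine ⟨K, hK, ?_, ?_⟩
  · have h1 := hmax H (by simp)
    have h2 : ((shadowSet H).card : ℝ) ≤ (n : ℝ) ^ 2 := by
      have : (shadowSet H).card ≤ n ^ 2 := by
        refine (Finset.card_le_univ _).trans ?_
        simp [sq]
      exact_mod_cast this
    have h3 : 0 ≤ c * ((shadowSet K).card : ℝ) := by positivity
    have h4 := mul_le_mul_of_nonneg_left h2 hc
    linarith
  · intro x y z hz
    by_contra! hlt
    set I := (linkSet K x y).image fun z => ({x, y, z} : Finset (Fin n)) with hI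
    have hIK : I ⊆ K := by
      intro e he
      obtain ⟨t, ht, rfl⟩ := Finset.mem_image.1 he
      exact mem_linkSet.1 ht
    have h1 := hmax (K \ I) (Finset.mem_powerset.2 (Finset.sdiff_subset.trans hK))
    have h2 : (K \ I).card + I.card = K.card := Finset.card_sdiff_add_card_eq_card hIK
    have h3 : I.card ≤ (linkSet K x y).card := Finset.card_image_le
    have h4 : shadowSet (K \ I) ⊂ shadowSet K := by
      refine (Finset.ssubset_iff_of_subset ?_).2 ⟨(x, y), mem_shadowSet.2 ⟨z, hz⟩, ?_⟩
      · rintro ⟨a, b⟩ h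
        obtain ⟨t, ht⟩ := mem_shadowSet.1 h
        exact mem_shadowSet.2 ⟨t, (Finset.mem_sdiff.1 ht).1⟩
      · intro h
        obtain ⟨t, ht⟩ := mem_shadowSet.1 h
        obtain ⟨ht1, ht2⟩ := Finset.mem_sdiff.1 ht
        exact ht2 (Finset.mem_image.2 ⟨t, mem_linkSet.2 ht1, rfl⟩)
    have h5 := Finset.card_lt_card h4
    have h6 : ((shadowSet (K \ I)).card : ℝ) + 1 ≤ (shadowSet K).card := by exact_mod_cast h5
    have h7 := mul_le_mul_of_nonneg_left h6 hc
    have h8 : ((K \ I).card : ℝ) + I.card = K.card := by exact_mod_cast h2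
    have h9 : (I.card : ℝ) ≤ (linkSet K x y).card := by exact_mod_cast h3
    linarith

theorem triple_rot {n : ℕ} (x y z : Fin n) : ({y, z, x} : Finset (Fin n)) = {x, y, z} := by
  ext t; simp; tauto

theorem triple_swap {n : ℕ} (x y z : Fin n) : ({z, y, x} : Finset (Fin n)) = {x, y, z} := by
  ext t; simp; tauto

theorem card_ballSet {n : ℕ} {K : Finset (Finset (Fin n))} {c : ℝ} (hc : 0 ≤ c)
    (hK : ∀ x y z : Fin n, ({x, y, z} : Finset (Fin n)) ∈ K → c ≤ (linkSet K x y).card)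
    {x y z : Fin n} (h : ({x, y, z} : Finset (Fin n)) ∈ K) :
    c ^ 2 ≤ ((ballSet K x y).card : ℝ) := by
  have h1 : ((linkSet K x y).sigma fun a => linkSet K y a).card ≤ (ballSet K x y).card := by
    refine Finset.card_le_card_of_injOn (fun p => (p.1, p.2)) ?_ ?_
    · rintro ⟨a, b⟩ hab
      simpa [ballSet] using hab
    · rintro ⟨a, b⟩ _ ⟨a', b'⟩ _ hab
      simp only [Prod.mk.injEq] at hab
      obtain ⟨rfl, rfl⟩ := hab
      rfl
  rw [Finset.card_sigma] at h1
  have h2 : (linkSet K x y).card * c ≤ ∑ a ∈ linkSet K x y, ((linkSet K y a).card : ℝ) := by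
    rw [← nsmul_eq_mul]
    refine Finset.card_nsmul_le_sum _ _ _ fun a ha => hK y a x ?_
    rw [triple_rot]
    exact mem_linkSet.1 ha
  have h3 : (∑ a ∈ linkSet K x y, ((linkSet K y a).card : ℝ)) ≤ (ballSet K x y).card := by
    exact_mod_cast h1
  have h4 := mul_le_mul_of_nonneg_right (hK x y z h) hc
  nlinarith

/-- Shortcut: if two balls along a pseudopath meet, there is a detour. -/
theorem shortcut {n : ℕ} {K : Finset (Finset (Fin n))} {m : ℕ} {v : ℕ → Fin n}
    {x y z w : Fin n} (hv : IsPseudopathFrom K m v x y z w) {i j : ℕ} (hij : i + 6 < j)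
    (hj : j + 3 ≤ m) {p : Fin n × Fin n} (hi : p ∈ ballSet K (v i) (v (i + 1)))
    (hp : p ∈ ballSet K (v j) (v (j + 1))) :
    ∃ v', IsPseudopathFrom K (m - j + i + 6) v' x y z w := by
  obtain ⟨a, b⟩ := p
  simp only [ballSet, Finset.mem_filter, Finset.mem_univ, true_and, mem_linkSet] at hi hp
  obtain ⟨he, hx, hy, hz, hw⟩ := hv
  set v' : ℕ → Fin n := fun t => if t ≤ i + 1 then v t else if t = i + 2 then a else
    if t = i + 3 then b else if t = i + 4 then v (j + 1) else if t = i + 5 then a else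
    v (t + j - (i + 6)) with hv'
  have e1 : ∀ t, t ≤ i + 1 → v' t = v t := fun t ht => by simp [hv', ht]
  have e2 : v' (i + 2) = a := by simp [hv']
  have e3 : v' (i + 3) = b := by simp [hv']
  have e4 : v' (i + 4) = v (j + 1) := by simp [hv']
  have e5 : v' (i + 5) = a := by simp [hv']
  have e6 : ∀ s, v' (i + 6 + s) = v (j + s) := fun s => by
    have h : i + 6 + s + j - (i + 6) = j + s := by omega
    have n1 : ¬ (i + 6 + s ≤ i + 1) := by omega
    have n2 : ¬ (i + 6 + s = i + 2) := by omega
    have n3 : ¬ (i + 6 + s = i + 3) := by omega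
    have n4 : ¬ (i + 6 + s = i + 4) := by omega
    have n5 : ¬ (i + 6 + s = i + 5) := by omega
    simp only [hv', n1, n2, n3, n4, n5, if_false, h]
  refine ⟨v', ?_, ?_, ?_, ?_, ?_⟩
  · intro t ht
    rcases (by omega : t + 2 ≤ i + 1 ∨ t = i ∨ t = i + 1 ∨ t = i + 2 ∨ t = i + 3 ∨ t = i + 4 ∨
      t = i + 5 ∨ i + 6 ≤ t) with h | h | h | h | h | h | h | h
    · rw [e1 _ (by omega), e1 _ (by omega), e1 _ (by omega)]
      exact he t (by omega)
    · subst h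
      rw [e1 _ (by omega), e1 _ (by omega), e2]
      exact hi.1
    · subst h
      rw [e1 _ (by omega), e2, e3]
      exact hi.2
    · subst h
      rw [e2, e3, e4, triple_rot]
      exact hp.2
    · subst h
      rw [e3, e4, e5, ← triple_rot]
      exact hp.2
    · subst h
      have := e6 0
      simp only [add_zero] at this
      rw [e4, e5, this, triple_rot]
      exact hp.1
    · subst h
      have h0 := e6 0
      have h1 := e6 1
      simp only [add_zero] at h0
      rw [e5, h0, h1, ← triple_rot]
      exact hp.1
    · obtain ⟨s, rfl⟩ := Nat.exists_eq_add_of_le h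
      rw [e6, add_assoc (i + 6), e6, add_assoc (i + 6), e6]
      exact he (j + s) (by omega)
  · rw [e1 _ (by omega), hx]
  · rw [e1 _ (by omega), hy]
  · rw [show m - j + i + 6 - 2 = i + 6 + (m - 2 - j) by omega, e6, ← hz]
    congr 1; omega
  · rw [show m - j + i + 6 - 1 = i + 6 + (m - 1 - j) by omega, e6, ← hw]
    congr 1; omega

/-- For every `ε > 0` there is `ℓ` such that every 3-uniform hypergraph `H` on `n`
vertices has a subhypergraph `H'` with `e(H') ≥ e(H) − εn³` and diameter at most `ℓ`. -/
theorem small_diameter_subgraph :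
    ∀ ε : ℝ, 0 < ε → ∃ ℓ : ℕ, ∀ n : ℕ, ∀ H : Finset (Finset (Fin n)),
      (∀ e ∈ H, e.card = 3) →
      ∃ H' : Finset (Finset (Fin n)), H' ⊆ H ∧
        ((H'.card : ℝ) ≥ (H.card : ℝ) - ε * (n : ℝ) ^ 3) ∧ DiamAtMost H' ℓ := by
  intro ε hε
  obtain ⟨Q, hQ⟩ := exists_nat_gt (1 / ε ^ 2)
  refine ⟨7 * Q + 3, fun n H _ => ?_⟩
  have hc : 0 ≤ ε * n := by positivity
  obtain ⟨K, hKH, hcard, hK⟩ := exists_clean H (ε * n) hc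
  refine ⟨K, hKH, by rw [show ε * (n : ℝ) ^ 3 = ε * n * n ^ 2 by ring]; exact hcard, ?_⟩
  intro x y z w _ _ hex
  classical
  obtain ⟨v, hm2, hv⟩ := Nat.find_spec hex
  have hmin := fun k => @Nat.find_min _ _ hex k
  set m := Nat.find hex
  refine ⟨m, v, hm2, ?_, hv⟩
  by_contra! hlt
  have hdisj : ∀ k ∈ Finset.range Q, ∀ l ∈ Finset.range Q, k < l →
      Disjoint (ballSet K (v (7 * k)) (v (7 * k + 1))) (ballSet K (v (7 * l)) (v (7 * l + 1))) := by
    intro k hk l hl hkl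
    rw [Finset.mem_range] at hk hl
    rw [Finset.disjoint_left]
    intro p hp hp'
    obtain ⟨v', h'⟩ := shortcut hv (by omega) (by omega) hp hp'
    exact hmin (m - 7 * l + 7 * k + 6) (by omega) ⟨v', by omega, h'⟩
  have hU : ((Finset.range Q).biUnion
      fun k => ballSet K (v (7 * k)) (v (7 * k + 1))).card ≤ n ^ 2 := by
    refine (Finset.card_le_univ _).trans ?_
    simp [sq]
  rw [Finset.card_biUnion] at hU
  · have h1 : (Q : ℝ) * (ε * n) ^ 2 ≤
        ∑ k ∈ Finset.range Q, ((ballSet K (v (7 * k)) (v (7 * k + 1))).card : ℝ) := by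
      have := Finset.card_nsmul_le_sum (Finset.range Q)
        (fun k => ((ballSet K (v (7 * k)) (v (7 * k + 1))).card : ℝ)) ((ε * n) ^ 2)
        fun k hk => by
          rw [Finset.mem_range] at hk
          exact card_ballSet hc hK (hv.1 (7 * k) (by omega))
      simpa using this
    have h2 : (∑ k ∈ Finset.range Q, ((ballSet K (v (7 * k)) (v (7 * k + 1))).card : ℝ))
        ≤ (n : ℝ) ^ 2 := by exact_mod_cast hU
    have hn : (0 : ℝ) < n := by exact_mod_cast x.pos
    rw [div_lt_iff₀ (by positivity)] at hQ
    have h3 : (n : ℝ) ^ 2 * 1 < n ^ 2 * (Q * ε ^ 2) :=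
      mul_lt_mul_of_pos_left hQ (by positivity)
    nlinarith
  · intro k hk l hl hkl
    rcases lt_or_gt_of_ne hkl with h | h
    · exact hdisj k hk l hl h
    · exact (hdisj l hl k hk h).symm
end
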